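/- arXiv:1505.04917 — 3 statements merged into one kernel-verified Lean document; each statement's English description precedes it below -/
import Mathlib

section
/- Let D ⊆ ℂⁿ be a B-regular bounded domain and let A ⊆ ∂D be b-pluripolar. Then Â ∩ ∂D = A, i.e. the b-pluripolar hull of A contains no boundary points of D other than the points of A itself. -/
open Complex Metric MeasureTheory Filter Topology Set

noncomputable section

/-- The average of the truncation `max u (-m)` of an `EReal`-valued function `u` over the
circle of center `c` and radius `r`. -/
noncomputable def truncCircleAvg (u : ℂ → EReal) (c : ℂ) (r : ℝ) (m : ℕ) : ℝ :=
  (2 * Real.pi)⁻¹ *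
    ∫ θ in (0:ℝ)..(2 * Real.pi),
      (max (u (c + (r : ℂ) * Complex.exp (θ * Complex.I))) ((-(m : ℝ) : ℝ) : EReal)).toReal

/-- A `[-∞,∞]`-valued function is subharmonic on `U ⊆ ℂ` if it is upper semicontinuous
on `U` and satisfies the sub-mean value inequality on every closed disc contained in `U`
(expressed via averages of truncations from below). -/
def SubharmonicOn (u : ℂ → EReal) (U : Set ℂ) : Prop :=
  UpperSemicontinuousOn u U ∧
    ∀ c r, 0 < r → Metric.closedBall c r ⊆ U →
      ∀ m : ℕ, u c ≤ ((truncCircleAvg u c r m : ℝ) : EReal)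

variable {E : Type*} [NormedAddCommGroup E] [NormedSpace ℂ E]

/-- Plurisubharmonic on `D`: upper semicontinuous on `D`, with values in `[-∞, ∞)`,
whose restriction to every complex line is subharmonic.  (The constant `-∞` is allowed
here; the paper's class `PSH(D)` additionally requires `u ≢ -∞`, see `MemPSH`.) -/
def PshOn (u : E → EReal) (D : Set E) : Prop :=
  UpperSemicontinuousOn u D ∧ (∀ z ∈ D, u z ≠ ⊤) ∧
    ∀ a b : E, SubharmonicOn (fun ζ : ℂ => u (a + ζ • b)) {ζ : ℂ | a + ζ • b ∈ D}

/-- Membership in the paper's class `PSH(D)`: plurisubharmonic and not identically `-∞`. -/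
def MemPSH (u : E → EReal) (D : Set E) : Prop :=
  PshOn u D ∧ ∃ z ∈ D, u z ≠ ⊥

/-- The upper semicontinuous regularization `u*` of `u` on `cl(D)`:
`u*(x) = limsup_{z → x, z ∈ D} u(z)`. -/
noncomputable def uscReg (u : E → EReal) (D : Set E) (x : E) : EReal :=
  Filter.limsup u (nhdsWithin x D)

/-- The boundary relative extremal function
`ω(z, A, D) = sup { u(z) : u ∈ PSH(D), u ≤ 0 on D, u* ≤ -1 on A }`. -/
noncomputable def bndExt (z : E) (A D : Set E) : EReal :=
  sSup {w : EReal | ∃ u : E → EReal, MemPSH u D ∧ (∀ y ∈ D, u y ≤ 0) ∧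
    (∀ x ∈ A, uscReg u D x ≤ -1) ∧ w = u z}

/-- The upper semicontinuous regularization `ω*(·, A, D)` on `cl(D)`. -/
noncomputable def bndExtStar (x : E) (A D : Set E) : EReal :=
  Filter.limsup (fun z => bndExt z A D) (nhdsWithin x D)

/-- A bounded domain: a nonempty connected bounded open set. -/
def IsBddDomain (D : Set E) : Prop :=
  IsOpen D ∧ IsConnected D ∧ Bornology.IsBounded D

/-- `A ⊆ ∂D` is b-pluripolar if there is `u ∈ PSH(D)`, `u ≤ 0`, `u ≢ -∞`,
with `u* = -∞` on `A`. -/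
def BPluripolar (A D : Set E) : Prop :=
  ∃ u : E → EReal, PshOn u D ∧ (∀ z ∈ D, u z ≤ 0) ∧ (∃ z ∈ D, u z ≠ ⊥) ∧
    ∀ x ∈ A, uscReg u D x = ⊥

/-- The b-pluripolar hull `Â` of `A ⊆ ∂D`: all points `z ∈ cl(D)` such that `u*(z) = -∞`
for every negative `u ∈ PSH(D)`, `u ≢ -∞`, with `u* = -∞` on `A`. -/
def bHull (A D : Set E) : Set E :=
  {z ∈ closure D | ∀ u : E → EReal, PshOn u D → (∀ y ∈ D, u y < 0) →
    (∃ y ∈ D, u y ≠ ⊥) → (∀ x ∈ A, uscReg u D x = ⊥) → uscReg u D z = ⊥}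

/-- Weak regularity: for every relatively open `U ⊆ ∂D` one has `ω*(·, U, D) ≤ -1` on `U`. -/
def WeaklyRegular (D : Set E) : Prop :=
  ∀ U W : Set E, IsOpen W → U = W ∩ frontier D → ∀ x ∈ U, bndExtStar x U D ≤ -1

/-- B-regularity (Sibony): every continuous `f : ∂D → ℝ` extends to a function
plurisubharmonic on `D` and continuous on `cl(D)` with boundary values `f`. -/
def BRegular (D : Set E) : Prop :=
  ∀ f : E → ℝ, ContinuousOn f (frontier D) →
    ∃ F : E → ℝ, ContinuousOn F (closure D) ∧
      PshOn (fun z => ((F z : ℝ) : EReal)) D ∧ ∀ x ∈ frontier D, F x = f x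

/-- The extremal function `ω₁(z, K, D)`, defined with continuous-up-to-the-boundary
plurisubharmonic competitors. -/
noncomputable def bndExtCont (z : E) (K D : Set E) : EReal :=
  sSup {w : EReal | ∃ F : E → ℝ, ContinuousOn F (closure D) ∧
    PshOn (fun y => ((F y : ℝ) : EReal)) D ∧ (∀ y ∈ closure D, F y ≤ 0) ∧
    (∀ x ∈ K, F x ≤ -1) ∧ w = ((F z : ℝ) : EReal)}

end

section helpers

set_option linter.unusedSectionVars false

variable {E : Type*} [NormedAddCommGroup E] [NormedSpace ℂ E]

/-- Real-valued truncation. -/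
noncomputable def um (u : E → EReal) (m : ℕ) (z : E) : ℝ :=
  (max (u z) ((-(m : ℝ) : ℝ) : EReal)).toReal

/-- Circle average. -/
noncomputable def cavg (g : E → ℝ) (p b : E) : ℝ :=
  (2 * Real.pi)⁻¹ * ∫ θ in (0:ℝ)..(2 * Real.pi), g (p + Complex.exp (θ * Complex.I) • b)

/-- Bounded real psh functions. -/
structure RPsh (g : E → ℝ) (D : Set E) : Prop where
  usc : UpperSemicontinuousOn g D
  bdd : ∃ C, ∀ z ∈ D, |g z| ≤ C
  sub : ∀ p b : E, (∀ ζ : ℂ, ‖ζ‖ ≤ 1 → p + ζ • b ∈ D) → g p ≤ cavg g p b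

lemma ecoe_max (x y : ℝ) : ((max x y : ℝ) : EReal) = max (x : EReal) (y : EReal) :=
  EReal.coe_strictMono.monotone.map_max

lemma circ_mem {D : Set E} {p b : E} (h : ∀ ζ : ℂ, ‖ζ‖ ≤ 1 → p + ζ • b ∈ D) (θ : ℝ) :
    p + Complex.exp (θ * Complex.I) • b ∈ D :=
  h _ (by rw [Complex.norm_exp_ofReal_mul_I])

lemma center_mem {D : Set E} {p b : E} (h : ∀ ζ : ℂ, ‖ζ‖ ≤ 1 → p + ζ • b ∈ D) : p ∈ D := by
  simpa using h 0 (by simp)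

lemma circ_cont (p b : E) : Continuous fun θ : ℝ => p + Complex.exp (θ * Complex.I) • b := by
  fun_prop

lemma usc_circ {β : Type*} [Preorder β] {D : Set E} {g : E → β}
    (hg : UpperSemicontinuousOn g D) {p b : E}
    (h : ∀ ζ : ℂ, ‖ζ‖ ≤ 1 → p + ζ • b ∈ D) :
    UpperSemicontinuous fun θ : ℝ => g (p + Complex.exp (θ * Complex.I) • b) := by
  rw [← upperSemicontinuousOn_univ_iff]
  exact UpperSemicontinuousOn.comp hg (circ_cont p b).continuousOn (fun θ _ => circ_mem h θ)

lemma intble_of_meas_bdd {f : ℝ → ℝ} (hf : Measurable f) {C : ℝ} (hC : ∀ θ, |f θ| ≤ C) (a b : ℝ) :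
    IntervalIntegrable f volume a b := by
  refine (intervalIntegrable_const (c := C)).mono_fun hf.aestronglyMeasurable ?_
  refine Eventually.of_forall fun θ => ?_
  simpa using (hC θ).trans (le_abs_self C)

lemma RPsh.intble {D : Set E} {g : E → ℝ} (hg : RPsh g D) {p b : E}
    (h : ∀ ζ : ℂ, ‖ζ‖ ≤ 1 → p + ζ • b ∈ D) (x y : ℝ) :
    IntervalIntegrable (fun θ : ℝ => g (p + Complex.exp (θ * Complex.I) • b)) volume x y := by
  obtain ⟨C, hC⟩ := hg.bdd
  exact intble_of_meas_bdd (usc_circ hg.usc h).measurable (fun θ => hC _ (circ_mem h θ)) x y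

lemma cavg_mono {D : Set E} {f g : E → ℝ} (hf : RPsh f D) {p b : E}
    (h : ∀ ζ : ℂ, ‖ζ‖ ≤ 1 → p + ζ • b ∈ D)
    (hg : IntervalIntegrable (fun θ : ℝ => g (p + Complex.exp (θ * Complex.I) • b))
      volume 0 (2 * Real.pi))
    (hfg : ∀ z ∈ D, f z ≤ g z) : cavg f p b ≤ cavg g p b := by
  unfold cavg
  refine mul_le_mul_of_nonneg_left ?_ (by positivity)
  exact intervalIntegral.integral_mono Real.two_pi_pos.le (hf.intble h _ _) hg
    (fun θ => hfg _ (circ_mem h θ))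

lemma cavg_const (c : ℝ) (p b : E) : cavg (fun _ => c) p b = c := by
  unfold cavg
  simp only [intervalIntegral.integral_const, sub_zero, smul_eq_mul]
  field_simp

lemma RPsh.const (c : ℝ) (D : Set E) : RPsh (fun _ => c) D where
  usc := upperSemicontinuousOn_const
  bdd := ⟨|c|, fun _ _ => le_rfl⟩
  sub := fun p b _ => (cavg_const c p b).ge

lemma RPsh.add {D : Set E} {f g : E → ℝ} (hf : RPsh f D) (hg : RPsh g D) :
    RPsh (fun z => f z + g z) D where
  usc := hf.usc.add hg.usc
  bdd := by
    obtain ⟨C, hC⟩ := hf.bdd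
    obtain ⟨C', hC'⟩ := hg.bdd
    exact ⟨C + C', fun z hz => (abs_add_le _ _).trans (add_le_add (hC z hz) (hC' z hz))⟩
  sub := fun p b h => by
    have : cavg (fun z => f z + g z) p b = cavg f p b + cavg g p b := by
      unfold cavg
      rw [intervalIntegral.integral_add (hf.intble h _ _) (hg.intble h _ _)]
      ring
    rw [this]
    exact add_le_add (hf.sub p b h) (hg.sub p b h)

lemma RPsh.maxi {D : Set E} {f g : E → ℝ} (hf : RPsh f D) (hg : RPsh g D) :
    RPsh (fun z => max (f z) (g z)) D := by
  have husc : UpperSemicontinuousOn (fun z => max (f z) (g z)) D := hf.usc.sup hg.usc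
  have hb : ∃ C, ∀ z ∈ D, |max (f z) (g z)| ≤ C := by
    obtain ⟨C, hC⟩ := hf.bdd
    obtain ⟨C', hC'⟩ := hg.bdd
    exact ⟨_, fun z hz => abs_max_le_max_abs_abs.trans (max_le_max (hC z hz) (hC' z hz))⟩
  refine ⟨husc, hb, fun p b h => ?_⟩
  obtain ⟨C, hC⟩ := hb
  have hi := intble_of_meas_bdd (usc_circ husc h).measurable (fun θ => hC _ (circ_mem h θ))
    0 (2 * Real.pi)
  refine max_le ((hf.sub p b h).trans ?_) ((hg.sub p b h).trans ?_)
  · exact cavg_mono hf h hi (fun z _ => le_max_left _ _)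
  · exact cavg_mono hg h hi (fun z _ => le_max_right _ _)

lemma RPsh.cmul {D : Set E} {f : E → ℝ} (hf : RPsh f D) {c : ℝ} (hc : 0 < c) :
    RPsh (fun z => c * f z) D where
  usc := by
    intro z hz y hy
    have := hf.usc z hz (y / c) (by
      change f z < y / c
      change c * f z < y at hy
      rw [lt_div_iff₀ hc]; linarith)
    filter_upwards [this] with w hw
    rw [lt_div_iff₀ hc] at hw
    linarith
  bdd := by
    obtain ⟨C, hC⟩ := hf.bdd
    refine ⟨c * C, fun z hz => ?_⟩
    rw [abs_mul, abs_of_pos hc]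
    exact mul_le_mul_of_nonneg_left (hC z hz) hc.le
  sub := fun p b h => by
    have : cavg (fun z => c * f z) p b = c * cavg f p b := by
      unfold cavg
      rw [intervalIntegral.integral_const_mul]
      ring
    rw [this]
    exact mul_le_mul_of_nonneg_left (hf.sub p b h) hc.le

lemma RPsh.congr {D : Set E} {f g : E → ℝ} (hf : RPsh f D) (hfg : ∀ z ∈ D, f z = g z) :
    RPsh g D where
  usc := by
    intro z hz y hy
    have := hf.usc z hz y (by
      change f z < y
      rw [hfg z hz]; exact hy)
    filter_upwards [this, self_mem_nhdsWithin] with w hw hwD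
    rw [← hfg w hwD]; exact hw
  bdd := by
    obtain ⟨C, hC⟩ := hf.bdd
    exact ⟨C, fun z hz => by rw [← hfg z hz]; exact hC z hz⟩
  sub := fun p b h => by
    have : cavg g p b = cavg f p b := by
      unfold cavg
      congr 2
      ext θ
      exact (hfg _ (circ_mem h θ)).symm
    rw [this, ← hfg p (center_mem h)]
    exact hf.sub p b h

lemma RPsh.sum {D : Set E} {f : ℕ → E → ℝ} (hf : ∀ j, RPsh (f j) D) (N : ℕ) :
    RPsh (fun z => -1 + ∑ j ∈ Finset.range N, f j z) D := by
  induction N with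
  | zero => simpa using RPsh.const (-1 : ℝ) D
  | succ N ih =>
    simp only [Finset.sum_range_succ, ← add_assoc]
    exact ih.add (hf N)

lemma coe_um {u : E → EReal} {z : E} (h : u z ≠ ⊤) (m : ℕ) :
    ((um u m z : ℝ) : EReal) = max (u z) ((-(m : ℝ) : ℝ) : EReal) := by
  refine EReal.coe_toReal ?_ ?_
  · rcases max_choice (u z) ((-(m : ℝ) : ℝ) : EReal) with h' | h' <;> rw [h']
    · exact h
    · exact EReal.coe_ne_top _
  · exact ((EReal.bot_lt_coe _).trans_le (le_max_right _ _)).ne'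

lemma um_ge {u : E → EReal} {z : E} (h : u z ≠ ⊤) (m : ℕ) : -(m : ℝ) ≤ um u m z := by
  rw [← EReal.coe_le_coe_iff, coe_um h]; exact le_max_right _ _

lemma le_um {u : E → EReal} {z : E} (h : u z ≠ ⊤) (m : ℕ) : u z ≤ um u m z := by
  rw [coe_um h]; exact le_max_left _ _

lemma disc_mem {D : Set E} {a b : E} {c : ℂ} {r : ℝ} (hr : 0 < r)
    (h : closedBall c r ⊆ {ζ : ℂ | a + ζ • b ∈ D}) :
    ∀ ζ : ℂ, ‖ζ‖ ≤ 1 → (a + c • b) + ζ • ((r : ℂ) • b) ∈ D := by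
  intro ζ hζ
  have : c + ζ * r ∈ closedBall c r := by
    simp only [mem_closedBall, dist_eq_norm, add_sub_cancel_left, norm_mul, Complex.norm_real,
      Real.norm_eq_abs, abs_of_pos hr]
    nlinarith
  have := h this
  simpa [add_smul, mul_smul, add_assoc] using this

lemma truncAvg_eq (u : E → EReal) (a b : E) (c : ℂ) (r : ℝ) (m : ℕ) :
    truncCircleAvg (fun ζ : ℂ => u (a + ζ • b)) c r m
      = cavg (um u m) (a + c • b) ((r : ℂ) • b) := by
  unfold truncCircleAvg cavg um
  congr 2
  ext θ
  congr 2
  change u _ = u _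
  congr 1
  rw [add_smul, mul_comm, mul_smul, add_assoc]

lemma RPsh.of_psh {D : Set E} {u : E → EReal} (hu : PshOn u D) {C : ℝ}
    (hC : ∀ z ∈ D, u z ≤ C) (m : ℕ) : RPsh (um u m) D := by
  have husc : UpperSemicontinuousOn (um u m) D := by
    intro z hz y hy
    have hy' : ((um u m z : ℝ) : EReal) < (y : EReal) := EReal.coe_lt_coe_iff.2 hy
    rw [coe_um (hu.2.1 z hz), max_lt_iff] at hy'
    filter_upwards [hu.1 z hz y hy'.1, self_mem_nhdsWithin] with w hw hwD
    rw [← EReal.coe_lt_coe_iff, coe_um (hu.2.1 w hwD)]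
    exact max_lt hw hy'.2
  have hbd : ∀ z ∈ D, |um u m z| ≤ max |C| m := by
    intro z hz
    have h1 := um_ge (hu.2.1 z hz) m
    have h2 : um u m z ≤ max C (-m) := by
      rw [← EReal.coe_le_coe_iff, coe_um (hu.2.1 z hz)]
      rw [ecoe_max]
      exact max_le_max (hC z hz) le_rfl
    have h3 : max C (-(m : ℝ)) ≤ max |C| m :=
      max_le_max (le_abs_self C) (by have : (0:ℝ) ≤ m := Nat.cast_nonneg m
                                     linarith)
    rw [abs_le]
    exact ⟨by linarith [le_max_right |C| (m : ℝ)], by linarith⟩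
  refine ⟨husc, ⟨_, hbd⟩, fun p b h => ?_⟩
  have hi := intble_of_meas_bdd (usc_circ husc h).measurable (fun θ => hbd _ (circ_mem h θ))
    0 (2 * Real.pi)
  rw [← EReal.coe_le_coe_iff, coe_um (hu.2.1 p (center_mem h))]
  refine max_le ?_ ?_
  · have := (hu.2.2 p b).2 0 1 one_pos (fun ζ hζ => h ζ (by simpa using hζ)) m
    rw [truncAvg_eq] at this
    simpa using this
  · rw [EReal.coe_le_coe_iff, ← cavg_const (-(m : ℝ)) p b]
    exact cavg_mono (RPsh.const _ D) h hi (fun z hz => um_ge (hu.2.1 z hz) m)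

lemma RPsh.of_real {D : Set E} {F : E → ℝ} (hF : PshOn (fun z => ((F z : ℝ) : EReal)) D)
    {C : ℝ} (hC : ∀ z ∈ D, |F z| ≤ C) : RPsh F D := by
  obtain ⟨m, hm⟩ := exists_nat_ge C
  refine (RPsh.of_psh hF (C := C) (fun z hz => ?_) m).congr (fun z hz => ?_)
  · exact EReal.coe_le_coe_iff.2 ((le_abs_self _).trans (hC z hz))
  · have h := (abs_le.1 (hC z hz)).1
    rw [um, ← ecoe_max, EReal.toReal_coe]
    exact max_eq_left (by linarith)

lemma psh_iInf {D : Set E} {S : ℕ → E → ℝ} (hS : ∀ N, RPsh (S N) D)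
    (hanti : ∀ z ∈ D, Antitone fun N => S N z) (hneg : ∀ N, ∀ z ∈ D, S N z ≤ 0) :
    PshOn (fun z => ⨅ N, ((S N z : ℝ) : EReal)) D := by
  set v : E → EReal := fun z => ⨅ N, ((S N z : ℝ) : EReal) with hv
  have husc : UpperSemicontinuousOn v D := by
    refine upperSemicontinuousOn_iInf fun N => ?_
    intro z hz y hy
    obtain ⟨q, hq1, hq2⟩ := EReal.lt_iff_exists_real_btwn.1 hy
    filter_upwards [(hS N).usc z hz q (EReal.coe_lt_coe_iff.1 hq1)] with w hw
    exact (EReal.coe_lt_coe_iff.2 hw).trans hq2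
  have hle : ∀ z N, v z ≤ S N z := fun z N => iInf_le _ N
  have hnt : ∀ z, v z ≠ ⊤ := fun z => ((hle z 0).trans_lt (EReal.coe_lt_top _)).ne
  refine ⟨husc, fun z _ => hnt z, fun a b => ⟨?_, ?_⟩⟩
  · exact UpperSemicontinuousOn.comp (g := fun ζ : ℂ => a + ζ • b) husc
      (by fun_prop) (fun ζ hζ => hζ)
  · intro c r hr hD m
    have h := disc_mem hr hD
    rw [truncAvg_eq]
    change v (a + c • b) ≤ _
    generalize a + c • b = p at h ⊢
    generalize (r : ℂ) • b = b' at h ⊢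
    have hT : ∀ N, RPsh (fun z => max (S N z) (-(m : ℝ))) D :=
      fun N => (hS N).maxi (RPsh.const _ D)
    have hb : ∀ N, v p ≤ (cavg (fun z => max (S N z) (-(m : ℝ))) p b' : ℝ) := by
      intro N
      refine (hle p N).trans (EReal.coe_le_coe_iff.2 ?_)
      exact (le_max_left _ _).trans ((hT N).sub p b' h)
    have hpt : ∀ z ∈ D, Tendsto (fun N => max (S N z) (-(m : ℝ))) atTop (𝓝 (um v m z)) := by
      intro z hz
      rw [← EReal.tendsto_coe, coe_um (hnt z)]
      simp only [ecoe_max]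
      have : Tendsto (fun N => ((S N z : ℝ) : EReal)) atTop (𝓝 (v z)) :=
        tendsto_atTop_iInf (fun i j hij => EReal.coe_le_coe_iff.2 (hanti z hz hij))
      exact this.max tendsto_const_nhds
    have hlim : Tendsto (fun N => cavg (fun z => max (S N z) (-(m : ℝ))) p b') atTop
        (𝓝 (cavg (um v m) p b')) := by
      unfold cavg
      refine Tendsto.const_mul _ ?_
      refine intervalIntegral.tendsto_integral_filter_of_dominated_convergence (fun _ => (m : ℝ))
        ?_ ?_ ?_ ?_
      · exact Eventually.of_forall fun N =>
          (usc_circ (hT N).usc h).measurable.aestronglyMeasurable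
      · refine Eventually.of_forall fun N => Eventually.of_forall fun θ _ => ?_
        have := hneg N _ (circ_mem h θ)
        have hm : (0:ℝ) ≤ m := Nat.cast_nonneg m
        rw [Real.norm_eq_abs, abs_le]
        exact ⟨le_max_right _ _, max_le (by linarith) (by linarith)⟩
      · exact intervalIntegrable_const
      · exact Eventually.of_forall fun θ _ => hpt _ (circ_mem h θ)
    exact ge_of_tendsto' (EReal.tendsto_coe.2 hlim) hb

/-- Propagation of `-∞` along discs. -/
lemma bot_of_near {D : Set E} {u : E → EReal} (hu : PshOn u D) (hneg : ∀ z ∈ D, u z ≤ 0)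
    {p b : E} (h : ∀ ζ : ℂ, ‖ζ‖ ≤ 1 → p + ζ • b ∈ D)
    (hq : ∀ᶠ z in 𝓝 (p + b), u z = ⊥) : u p = ⊥ := by
  have hc : Tendsto (fun θ : ℝ => p + Complex.exp (θ * Complex.I) • b) (𝓝 0) (𝓝 (p + b)) := by
    have := (circ_cont p b).tendsto 0
    simpa using this
  obtain ⟨δ, hδ, hball⟩ := Metric.eventually_nhds_iff.1 (hc.eventually hq)
  set δ' := min (δ / 2) Real.pi with hδ'
  have hδ0 : 0 < δ' := lt_min (by linarith) Real.pi_pos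
  have hδ1 : δ' ≤ δ / 2 := min_le_left _ _
  have hδ2 : δ' ≤ 2 * Real.pi := (min_le_right _ _).trans (by linarith [Real.pi_pos])
  have key : ∀ m : ℕ, u p ≤ ((-(m * δ' * (2 * Real.pi)⁻¹) : ℝ) : EReal) := by
    intro m
    have hR := RPsh.of_psh hu (C := 0) (by simpa using hneg) m
    refine (le_um (hu.2.1 p (center_mem h)) m).trans (EReal.coe_le_coe_iff.2 ?_)
    refine (hR.sub p b h).trans ?_
    unfold cavg
    rw [← intervalIntegral.integral_add_adjacent_intervals (hR.intble h 0 δ')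
      (hR.intble h δ' (2 * Real.pi))]
    have hum0 : ∀ z ∈ D, um u m z ≤ 0 := by
      intro z hz
      rw [← EReal.coe_le_coe_iff, coe_um (hu.2.1 z hz)]
      refine max_le (by simpa using hneg z hz) (EReal.coe_le_coe_iff.2 (by simp))
    have h2 : ∫ θ in δ'..(2 * Real.pi), um u m (p + Complex.exp (θ * Complex.I) • b) ≤ 0 := by
      have := intervalIntegral.integral_mono hδ2 (hR.intble h δ' (2 * Real.pi))
        (intervalIntegrable_const (c := (0:ℝ))) (fun θ => hum0 _ (circ_mem h θ))
      simpa using this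
    have h1 : ∫ θ in (0:ℝ)..δ', um u m (p + Complex.exp (θ * Complex.I) • b) = -(m * δ') := by
      have : ∫ θ in (0:ℝ)..δ', um u m (p + Complex.exp (θ * Complex.I) • b)
          = ∫ θ in (0:ℝ)..δ', (-(m : ℝ)) := by
        refine intervalIntegral.integral_congr fun θ hθ => ?_
        rw [uIcc_of_le hδ0.le] at hθ
        have : u (p + Complex.exp (θ * Complex.I) • b) = ⊥ := by
          apply hball
          rw [Real.dist_eq, sub_zero, abs_of_nonneg hθ.1]
          linarith [hθ.2]
        simp only [um, this, bot_le, sup_of_le_right, EReal.toReal_coe]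
      rw [this]
      simp
      ring
    rw [h1]
    have : (0:ℝ) ≤ (2 * Real.pi)⁻¹ := by positivity
    nlinarith
  rw [EReal.eq_bot_iff_forall_lt]
  intro y
  have hpos : 0 < δ' * (2 * Real.pi)⁻¹ := by
    have := Real.pi_pos
    positivity
  obtain ⟨m, hm⟩ := exists_nat_gt (-y / (δ' * (2 * Real.pi)⁻¹))
  refine (key m).trans_lt (EReal.coe_lt_coe_iff.2 ?_)
  rw [div_lt_iff₀ hpos] at hm
  linarith

lemma frequently_ne_bot {D : Set E} (hDo : IsOpen D) (hDc : IsPreconnected D)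
    {u : E → EReal} (hu : PshOn u D) (hneg : ∀ z ∈ D, u z ≤ 0) (hne : ∃ z ∈ D, u z ≠ ⊥)
    {x : E} (hx : x ∈ closure D) : ∃ᶠ z in 𝓝[D] x, u z ≠ ⊥ := by
  intro hcon
  have hcon' : ∀ᶠ z in 𝓝[D] x, u z = ⊥ := by simpa using hcon
  set W := interior {z | z ∈ D ∧ u z = ⊥} with hW
  obtain ⟨V, hVx, hV⟩ : ∃ V ∈ 𝓝 x, ∀ z ∈ V ∩ D, u z = ⊥ := by
    obtain ⟨V, hVx, hV⟩ := mem_nhdsWithin_iff_exists_mem_nhds_inter.1 hcon'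
    exact ⟨V, hVx, fun z hz => hV hz⟩
  have hWne : (D ∩ W).Nonempty := by
    obtain ⟨z, hz1, hz2⟩ := mem_closure_iff_nhds.1 hx (interior V) (interior_mem_nhds.2 hVx)
    refine ⟨z, hz2, mem_interior.2 ⟨interior V ∩ D, fun w hw => ⟨hw.2, hV w ⟨interior_subset hw.1, hw.2⟩⟩,
      isOpen_interior.inter hDo, hz1, hz2⟩⟩
  have hsub : D ⊆ W := by
    refine hDc.subset_of_closure_inter_subset isOpen_interior hWne ?_
    rintro p ⟨hpW, hpD⟩
    obtain ⟨ρ, hρ, hball⟩ := Metric.isOpen_iff.1 hDo p hpD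
    obtain ⟨q, hqW, hq⟩ := Metric.mem_closure_iff.1 hpW (ρ / 3) (by linarith)
    refine mem_interior.2 ⟨ball p (ρ / 3), fun z hz => ⟨hball (ball_subset_ball (by linarith) hz), ?_⟩,
      isOpen_ball, mem_ball_self (by linarith)⟩
    refine bot_of_near hu hneg (b := q - z) (fun ζ hζ => hball ?_) ?_
    · rw [mem_ball] at hz ⊢
      have h1 : dist (z + ζ • (q - z)) z ≤ dist q z := by
        rw [dist_eq_norm, add_sub_cancel_left, norm_smul, dist_eq_norm]
        exact mul_le_of_le_one_left (norm_nonneg _) hζ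
      have h2 := dist_triangle (z + ζ • (q - z)) z p
      have h3 := dist_triangle q p z
      rw [dist_comm p q] at hq
      rw [dist_comm p z] at h3
      linarith
    · rw [add_sub_cancel]
      filter_upwards [isOpen_interior.mem_nhds hqW] with w hw
      exact (interior_subset hw).2
  obtain ⟨z, hz, hz'⟩ := hne
  exact hz' (interior_subset (hsub hz)).2

lemma max_principle [ProperSpace E] [Nontrivial E] {D : Set E} (hDo : IsOpen D)
    (hDb : Bornology.IsBounded D) {F : E → ℝ} (hFc : ContinuousOn F (closure D)) (hF : RPsh F D)
    (hfr : ∀ x ∈ frontier D, F x ≤ 0) : ∀ z ∈ D, F z ≤ 0 := by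
  intro z₀ hz₀
  by_contra! hpos
  have hK : IsCompact (closure D) := hDb.isCompact_closure
  obtain ⟨q, hq, hmax⟩ := hK.exists_isMaxOn ⟨z₀, subset_closure hz₀⟩ hFc
  have hM : 0 < F q := hpos.trans_le (hmax (subset_closure hz₀))
  have hKM : IsCompact (closure D ∩ F ⁻¹' {F q}) :=
    hK.of_isClosed_subset (hFc.preimage_isClosed_of_isClosed isClosed_closure isClosed_singleton)
      inter_subset_left
  obtain ⟨p, hp, hpmax⟩ := hKM.exists_isMaxOn ⟨q, hq, rfl⟩ continuous_norm.continuousOn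
  have hFp : F p = F q := hp.2
  have hpD : p ∈ D := by
    by_contra hpD
    have := hfr p (by rw [frontier, hDo.interior_eq]; exact ⟨hp.1, hpD⟩)
    linarith
  obtain ⟨b, hb⟩ : ∃ b : E, ∀ t : ℝ, 0 < t → ‖p‖ < ‖p + (t : ℂ) • b‖ := by
    by_cases hp0 : p = 0
    · obtain ⟨b, hb⟩ := exists_ne (0 : E)
      refine ⟨b, fun t ht => ?_⟩
      have := norm_pos_iff.2 hb
      simp only [hp0, norm_zero, zero_add, norm_smul, Complex.norm_real, Real.norm_eq_abs]
      have := abs_pos.2 ht.ne'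
      positivity
    · refine ⟨p, fun t ht => ?_⟩
      have h1 : p + (t : ℂ) • p = ((1 + t : ℝ) : ℂ) • p := by
        push_cast; rw [add_smul, one_smul]
      have := norm_pos_iff.2 hp0
      rw [h1, norm_smul, Complex.norm_real, Real.norm_eq_abs, abs_of_pos (by linarith)]
      nlinarith
  obtain ⟨ρ, hρ, hball⟩ := Metric.isOpen_iff.1 hDo p hpD
  set t : ℝ := ρ / (2 * (‖b‖ + 1)) with ht
  have hbn := norm_nonneg b
  have ht0 : 0 < t := by positivity
  have htb : t * ‖b‖ < ρ := by
    rw [ht, div_mul_eq_mul_div, div_lt_iff₀ (by positivity)]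
    nlinarith
  have hdisc : ∀ ζ : ℂ, ‖ζ‖ ≤ 1 → p + ζ • ((t : ℂ) • b) ∈ D := by
    intro ζ hζ
    apply hball
    rw [mem_ball, dist_eq_norm, add_sub_cancel_left, norm_smul, norm_smul, Complex.norm_real,
      Real.norm_eq_abs, abs_of_pos ht0]
    have : 0 ≤ t * ‖b‖ := by positivity
    nlinarith
  have hsub := hF.sub p _ hdisc
  have hlt : cavg F p ((t : ℂ) • b) < F q := by
    rw [← cavg_const (F q) p ((t : ℂ) • b)]
    unfold cavg
    refine mul_lt_mul_of_pos_left ?_ (by have := Real.pi_pos; positivity)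
    refine intervalIntegral.integral_lt_integral_of_continuousOn_of_le_of_exists_lt
      Real.two_pi_pos ?_ continuousOn_const ?_ ⟨0, ⟨le_rfl, Real.two_pi_pos.le⟩, ?_⟩
    · exact hFc.comp (circ_cont _ _).continuousOn
        (fun θ _ => subset_closure (circ_mem hdisc θ))
    · exact fun θ _ => hmax (subset_closure (circ_mem hdisc θ))
    · have hmem := subset_closure (circ_mem hdisc 0)
      refine lt_of_le_of_ne (hmax hmem) fun heq => ?_
      have := hpmax (show _ ∈ closure D ∩ F ⁻¹' {F q} from ⟨hmem, heq⟩)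
      have h2 := hb t ht0
      have h3 : ‖p + Complex.exp (((0 : ℝ) : ℂ) * Complex.I) • ((t : ℂ) • b)‖ ≤ ‖p‖ := this
      rw [Complex.ofReal_zero, zero_mul, Complex.exp_zero, one_smul] at h3
      linarith
  linarith

end helpers

lemma sum_bound (k N : ℕ) :
    ∑ j ∈ Finset.range N, ((if j < k then 1 / ((k : ℝ) + 1) else 0) + (1 / 2 : ℝ) ^ j) ≤ 3 := by
  rw [Finset.sum_add_distrib]
  have h1 := sum_geometric_two_le N
  have h2 : ∑ j ∈ Finset.range N, (if j < k then 1 / ((k : ℝ) + 1) else 0) ≤ 1 := by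
    rw [← Finset.sum_filter, Finset.sum_const, nsmul_eq_mul]
    have hc : ((Finset.range N).filter (· < k)).card ≤ k := by
      have : (Finset.range N).filter (· < k) ⊆ Finset.range k := by
        intro j hj
        simp at hj ⊢
        exact hj.2
      simpa using Finset.card_le_card this
    have hc' : (((Finset.range N).filter (· < k)).card : ℝ) ≤ k := by exact_mod_cast hc
    rw [mul_one_div, div_le_one (by positivity)]
    linarith
  linarith

lemma exists_good {n : ℕ} {D A : Set (EuclideanSpace ℂ (Fin n))} (hD : IsBddDomain D)
    (hreg : BRegular D) (hA : A ⊆ frontier D) (hbp : BPluripolar A D)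
    {x₀ : EuclideanSpace ℂ (Fin n)} (hx₀ : x₀ ∈ frontier D) (hx₀A : x₀ ∉ A) :
    ∃ v : EuclideanSpace ℂ (Fin n) → EReal, PshOn v D ∧ (∀ y ∈ D, v y < 0) ∧
      (∃ y ∈ D, v y ≠ ⊥) ∧ (∀ x ∈ A, uscReg v D x = ⊥) ∧ uscReg v D x₀ ≠ ⊥ := by
  obtain ⟨hDo, hDc, hDb⟩ := hD
  obtain ⟨u, hu, hneg, hne, huA⟩ := hbp
  have hx₀D : x₀ ∉ D := by
    rw [frontier, hDo.interior_eq] at hx₀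
    exact hx₀.2
  have hnontriv : Nontrivial (EuclideanSpace ℂ (Fin n)) := by
    obtain ⟨y, hy⟩ := hDc.1
    exact ⟨x₀, y, fun h => hx₀D (h ▸ hy)⟩
  have hcl : frontier D ⊆ closure D := frontier_subset_closure
  obtain ⟨F, hFc, hFp, hFb⟩ := hreg (fun x => - dist x x₀) (by fun_prop)
  obtain ⟨C, hC⟩ := hDb.isCompact_closure.exists_bound_of_continuousOn hFc
  have hFR : RPsh F D := RPsh.of_real hFp (C := C) (fun z hz => hC z (subset_closure hz))
  have hF0 : ∀ z ∈ D, F z ≤ 0 := max_principle hDo hDb hFc hFR (fun x hx => by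
    rw [hFb x hx]; simp)
  have hfreq := frequently_ne_bot hDo hDc.isPreconnected hu hneg hne (hcl hx₀)
  have hseq : ∀ k : ℕ, ∃ z ∈ D, u z ≠ ⊥ ∧ dist z x₀ < 1 / ((k : ℝ) + 1) ∧
      -(1 / ((k : ℝ) + 1)) < F z := by
    intro k
    have hk : 0 < 1 / ((k : ℝ) + 1) := by positivity
    have h1 : ∀ᶠ z in 𝓝[D] x₀, dist z x₀ < 1 / ((k : ℝ) + 1) :=
      nhdsWithin_le_nhds (ball_mem_nhds x₀ hk)
    have h2 : ∀ᶠ z in 𝓝[D] x₀, -(1 / ((k : ℝ) + 1)) < F z := by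
      have : Tendsto F (𝓝[D] x₀) (𝓝 (F x₀)) :=
        (hFc x₀ (hcl hx₀)).mono_left (nhdsWithin_mono _ subset_closure)
      refine this.eventually (lt_mem_nhds ?_)
      rw [hFb x₀ hx₀, dist_self]
      linarith
    obtain ⟨z, hz, ⟨h1, h2⟩, hzD⟩ :=
      (hfreq.and_eventually ((h1.and h2).and self_mem_nhdsWithin)).exists
    exact ⟨z, hzD, hz, h1, h2⟩
  choose z hzD hzu hzd hzF using hseq
  let s : ℕ → ℝ := fun k => max 1 (-(u (z k)).toReal)
  have hs1 : ∀ k, 1 ≤ s k := fun k => le_max_left _ _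
  let P : ℕ → ℝ := fun j => ∑ i ∈ Finset.range (j + 1), s i
  have hPs : ∀ k j, k ≤ j → s k ≤ P j := fun k j hkj =>
    Finset.single_le_sum (f := s) (fun i _ => by linarith [hs1 i])
      (Finset.mem_range.2 (by omega))
  have hP0 : ∀ j, 0 < P j := fun j => by linarith [hPs j j le_rfl, hs1 j]
  let ε : ℕ → ℝ := fun j => (1 / 2 : ℝ) ^ j / P j
  have hε0 : ∀ j, 0 < ε j := fun j => div_pos (by positivity) (hP0 j)
  have hεs : ∀ k j, k ≤ j → ε j * s k ≤ (1 / 2 : ℝ) ^ j := by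
    intro k j hkj
    have h1 := hPs k j hkj
    change (1 / 2 : ℝ) ^ j / P j * s k ≤ _
    rw [div_mul_eq_mul_div, div_le_iff₀ (hP0 j)]
    exact mul_le_mul_of_nonneg_left h1 (by positivity)
  let m : ℕ → ℕ := fun j => ⌈1 / ε j⌉₊
  have hm : ∀ j, 1 ≤ ε j * m j := by
    intro j
    have : 1 / ε j ≤ m j := Nat.le_ceil _
    rwa [div_le_iff₀ (hε0 j), mul_comm] at this
  let g : ℕ → EuclideanSpace ℂ (Fin n) → ℝ := fun j w => max (ε j * um u (m j) w) (F w)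
  have hgR : ∀ j, RPsh (g j) D := fun j =>
    ((RPsh.of_psh hu (C := 0) (by simpa using hneg) (m j)).cmul (hε0 j)).maxi hFR
  have hum0 : ∀ j, ∀ w ∈ D, um u j w ≤ 0 := by
    intro j w hw
    rw [← EReal.coe_le_coe_iff, coe_um (hu.2.1 w hw)]
    exact max_le (by simpa using hneg w hw) (EReal.coe_le_coe_iff.2 (by simp))
  have hg0 : ∀ j, ∀ w ∈ D, g j w ≤ 0 := fun j w hw =>
    max_le (mul_nonpos_of_nonneg_of_nonpos (hε0 j).le (hum0 _ w hw)) (hF0 w hw)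
  let S : ℕ → EuclideanSpace ℂ (Fin n) → ℝ := fun N w => -1 + ∑ j ∈ Finset.range N, g j w
  have hS1 : ∀ N, ∀ w ∈ D, S N w ≤ -1 := by
    intro N w hw
    have := Finset.sum_nonpos (s := Finset.range N) (f := fun j => g j w) (fun j _ => hg0 j w hw)
    change -1 + _ ≤ (-1 : ℝ)
    linarith
  have hanti : ∀ w ∈ D, Antitone fun N => S N w := by
    intro w hw
    refine antitone_nat_of_succ_le fun N => ?_
    change -1 + _ ≤ -1 + _
    rw [Finset.sum_range_succ]
    linarith [hg0 N w hw]
  have hlow : ∀ k N, -4 ≤ S N (z k) := by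
    intro k N
    have hterm : ∀ j, -((if j < k then 1 / ((k : ℝ) + 1) else 0) + (1 / 2 : ℝ) ^ j)
        ≤ g j (z k) := by
      intro j
      have hp : (0:ℝ) < (1 / 2 : ℝ) ^ j := by positivity
      by_cases hjk : j < k
      · rw [if_pos hjk]
        have : F (z k) ≤ g j (z k) := le_max_right _ _
        linarith [hzF k]
      · rw [if_neg hjk]
        have h1 : ε j * um u (m j) (z k) ≤ g j (z k) := le_max_left _ _
        have h2 : -s k ≤ um u (m j) (z k) := by
          have ht := hu.2.1 _ (hzD k)
          have h3 := le_um ht (m j)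
          have h4 : (u (z k)).toReal ≤ um u (m j) (z k) := by
            rw [← EReal.coe_le_coe_iff, EReal.coe_toReal ht (hzu k)]
            exact h3
          have : -(u (z k)).toReal ≤ s k := le_max_right _ _
          linarith
        have h5 := hεs k j (not_lt.1 hjk)
        have h6 := mul_le_mul_of_nonneg_left h2 (hε0 j).le
        linarith
    have hsum := Finset.sum_le_sum (s := Finset.range N) (fun j _ => hterm j)
    rw [Finset.sum_neg_distrib] at hsum
    have := sum_bound k N
    change -4 ≤ -1 + ∑ j ∈ Finset.range N, g j (z k)
    linarith
  let v : EuclideanSpace ℂ (Fin n) → EReal := fun w => ⨅ N, ((S N w : ℝ) : EReal)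
  have hvlow : ∀ k, ((-4 : ℝ) : EReal) ≤ v (z k) := fun k =>
    le_iInf fun N => EReal.coe_le_coe_iff.2 (hlow k N)
  refine ⟨v, psh_iInf (fun N => RPsh.sum hgR N) hanti
    (fun N w hw => (hS1 N w hw).trans (by norm_num)), ?_, ?_, ?_, ?_⟩
  · intro y hy
    refine (iInf_le _ 0).trans_lt ?_
    have : S 0 y < 0 := (hS1 0 y hy).trans_lt (by norm_num)
    exact_mod_cast this
  · exact ⟨z 0, hzD 0, ((EReal.bot_lt_coe _).trans_le (hvlow 0)).ne'⟩
  · intro x hx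
    have hxf := hA hx
    have hd : 0 < dist x x₀ := dist_pos.2 (fun h => hx₀A (h ▸ hx))
    let η : ℝ := min 1 (dist x x₀ / 2)
    have hη : 0 < η := lt_min one_pos (by linarith)
    have hη1 : η ≤ 1 := min_le_left _ _
    have hη2 : η ≤ dist x x₀ / 2 := min_le_right _ _
    have hFx : ∀ᶠ w in 𝓝[D] x, F w < -(dist x x₀ / 2) := by
      have : Tendsto F (𝓝[D] x) (𝓝 (F x)) :=
        (hFc x (hcl hxf)).mono_left (nhdsWithin_mono _ subset_closure)
      refine this.eventually (gt_mem_nhds ?_)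
      rw [hFb x hxf]
      linarith
    have hgx : ∀ j, ∀ᶠ w in 𝓝[D] x, g j w ≤ -η := by
      intro j
      have hlt : ∀ᶠ w in 𝓝[D] x, u w < ((-(m j : ℝ) : ℝ) : EReal) := by
        refine eventually_lt_of_limsup_lt ?_
        have := huA x hx
        rw [uscReg] at this
        rw [this]
        exact EReal.bot_lt_coe _
      filter_upwards [hlt, hFx] with w h1 h2
      have h3 : um u (m j) w = -(m j : ℝ) := by
        rw [um, max_eq_right h1.le, EReal.toReal_coe]
      refine max_le ?_ (by linarith)
      rw [h3]
      linarith [hm j]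
    have hle : ∀ N : ℕ, uscReg v D x ≤ ((-(N * η) : ℝ) : EReal) := by
      intro N
      refine limsup_le_of_le (by isBoundedDefault) ?_
      have hall : ∀ᶠ w in 𝓝[D] x, ∀ j ∈ Finset.range N, g j w ≤ -η :=
        (Filter.eventually_all_finset _).2 (fun j _ => hgx j)
      filter_upwards [hall] with w hw
      refine (iInf_le _ N).trans (EReal.coe_le_coe_iff.2 ?_)
      have := Finset.sum_le_sum hw
      rw [Finset.sum_const, Finset.card_range, nsmul_eq_mul] at this
      change -1 + _ ≤ _
      linarith
    rw [EReal.eq_bot_iff_forall_lt]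
    intro y
    obtain ⟨N, hN⟩ := exists_nat_gt (-y / η)
    refine (hle N).trans_lt (EReal.coe_lt_coe_iff.2 ?_)
    rw [div_lt_iff₀ hη] at hN
    linarith
  · have hzt : Tendsto z atTop (𝓝[D] x₀) := by
      refine tendsto_nhdsWithin_iff.2 ⟨?_, Eventually.of_forall hzD⟩
      rw [tendsto_iff_dist_tendsto_zero]
      exact squeeze_zero (fun _ => dist_nonneg) (fun k => (hzd k).le)
        tendsto_one_div_add_atTop_nhds_zero_nat
    have hfr : ∃ᶠ w in 𝓝[D] x₀, ((-4 : ℝ) : EReal) ≤ v w :=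
      hzt.frequently (Eventually.of_forall hvlow).frequently
    have : ((-4 : ℝ) : EReal) ≤ uscReg v D x₀ :=
      le_limsup_of_frequently_le hfr (by isBoundedDefault)
    exact ((EReal.bot_lt_coe _).trans_le this).ne'

/-- If `D` is B-regular and `A ⊆ ∂D` is b-pluripolar, then the
b-pluripolar hull of `A` meets `∂D` exactly in `A`. -/
theorem bHull_inter_frontier_eq {n : ℕ}
    (D A : Set (EuclideanSpace ℂ (Fin n))) (hD : IsBddDomain D)
    (hreg : BRegular D) (hA : A ⊆ frontier D) (hbp : BPluripolar A D) :
    bHull A D ∩ frontier D = A := by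
  ext x
  constructor
  · rintro ⟨hx, hxf⟩
    by_contra hxA
    obtain ⟨v, h1, h2, h3, h4, h5⟩ := exists_good hD hreg hA hbp hxf hxA
    exact h5 (hx.2 v h1 h2 h3 h4)
  · intro hx
    exact ⟨⟨frontier_subset_closure (hA hx), fun u _ _ _ h => h x hx⟩, hA hx⟩
end

section
/- Let D ⊆ ℂⁿ be a B-regular bounded domain and let A ⊆ ∂D be b-pluripolar. Then the b-pluripolar hull of A is Â = A ∪ {z ∈ D : ω(z, A, D) < 0}. -/
open Complex Metric MeasureTheory Filter Topology Set

open scoped ENNReal NNReal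

/-- Circle point. -/
noncomputable def circPt {E : Type*} [NormedAddCommGroup E] [NormedSpace ℂ E] (p b : E) (θ : ℝ) : E :=
  p + Complex.exp (θ * Complex.I) • b

/-- `v ≥ 0` such that `-v` is plurisubharmonic. -/
def NegPsh {E : Type*} [NormedAddCommGroup E] [NormedSpace ℂ E] (v : E → ℝ≥0∞) (D : Set E) : Prop :=
  LowerSemicontinuousOn v D ∧
    ∀ p b : E, (∀ ζ : ℂ, ‖ζ‖ ≤ 1 → p + ζ • b ∈ D) →
      ∫⁻ θ in Set.Ioc (0:ℝ) (2 * Real.pi), v (circPt p b θ) ≤ ENNReal.ofReal (2 * Real.pi) * v p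

section aux
variable {E : Type*} [NormedAddCommGroup E] [NormedSpace ℂ E]

lemma continuous_circPt (p b : E) : Continuous (circPt p b) := by
  unfold circPt; fun_prop

lemma lsc_circ {v : E → ℝ≥0∞} {D : Set E} (hv : LowerSemicontinuousOn v D) {p b : E}
    (h : ∀ ζ : ℂ, ‖ζ‖ ≤ 1 → p + ζ • b ∈ D) : LowerSemicontinuous (fun θ => v (circPt p b θ)) := by
  rw [← lowerSemicontinuousOn_univ_iff]
  refine hv.comp (continuous_circPt p b).continuousOn ?_
  intro θ _
  exact h _ (by rw [Complex.norm_exp_ofReal_mul_I])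

lemma core_iff (f : ℝ → ℝ≥0∞) (hf : Measurable f) (x : ℝ≥0∞) :
    (∀ m : ℕ, -(x : EReal) ≤ (((2 * Real.pi)⁻¹ * ∫ θ in (0:ℝ)..(2 * Real.pi),
      (max (-(f θ : EReal)) ((-(m : ℝ) : ℝ) : EReal)).toReal : ℝ) : EReal)) ↔
    ∫⁻ θ in Set.Ioc (0:ℝ) (2 * Real.pi), f θ ≤ ENNReal.ofReal (2 * Real.pi) * x := by
  have hpi : 0 < 2 * Real.pi := by positivity
  have h1 : ∀ (m : ℕ) θ, (max (-(f θ : EReal)) ((-(m : ℝ) : ℝ) : EReal)).toReal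
      = - (min (f θ) (m : ℝ≥0∞)).toReal := by
    intro m θ
    have : max (-(f θ : EReal)) ((-(m : ℝ) : ℝ) : EReal)
      = -((min (f θ) (m : ℝ≥0∞) : ℝ≥0∞) : EReal) := by
      have h2 : ((-(m : ℝ) : ℝ) : EReal) = -(((m : ℝ≥0∞)) : EReal) := by
        rw [EReal.coe_neg]; rfl
      rw [h2]
      rcases le_total (f θ) (m : ℝ≥0∞) with h | h
      · rw [min_eq_left h, max_eq_left]
        exact EReal.neg_le_neg_iff.2 (EReal.coe_ennreal_le_coe_ennreal_iff.2 h)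
      · rw [min_eq_right h, max_eq_right]
        exact EReal.neg_le_neg_iff.2 (EReal.coe_ennreal_le_coe_ennreal_iff.2 h)
    rw [this, EReal.toReal_neg_eq, EReal.toReal_coe_ennreal]
  set I : ℕ → ℝ≥0∞ := fun m => ∫⁻ θ in Set.Ioc (0:ℝ) (2 * Real.pi), min (f θ) (m : ℝ≥0∞) with hI
  have hItop : ∀ m, I m ≠ ∞ := by
    intro m
    have : I m ≤ ∫⁻ θ in Set.Ioc (0:ℝ) (2 * Real.pi), (m : ℝ≥0∞) :=
      lintegral_mono (fun θ => min_le_right _ _)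
    refine ne_top_of_le_ne_top ?_ this
    simp only [lintegral_const, MeasurableSet.univ, Measure.restrict_apply, Set.univ_inter,
      Real.volume_Ioc]
    exact ENNReal.mul_ne_top (by simp) ENNReal.ofReal_ne_top
  have h2 : ∀ m : ℕ, (∫ θ in (0:ℝ)..(2 * Real.pi),
      (max (-(f θ : EReal)) ((-(m : ℝ) : ℝ) : EReal)).toReal) = - (I m).toReal := by
    intro m
    simp_rw [h1]
    rw [intervalIntegral.integral_of_le hpi.le, integral_neg, integral_toReal]
    · exact (hf.min measurable_const).aemeasurable
    · exact Filter.Eventually.of_forall fun θ => lt_of_le_of_lt (min_le_right _ _) (by simp)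
  have h3 : ∀ m : ℕ, (-(x : EReal) ≤ (((2 * Real.pi)⁻¹ * ∫ θ in (0:ℝ)..(2 * Real.pi),
      (max (-(f θ : EReal)) ((-(m : ℝ) : ℝ) : EReal)).toReal : ℝ) : EReal)) ↔
      I m ≤ ENNReal.ofReal (2 * Real.pi) * x := by
    intro m
    rw [h2, mul_neg, EReal.coe_neg, EReal.neg_le_neg_iff]
    induction x using ENNReal.recTopCoe with
    | top => simp [ENNReal.mul_top, Real.pi_pos]
    | coe x =>
      rw [← ENNReal.toReal_le_toReal (hItop m) (ENNReal.mul_ne_top ENNReal.ofReal_ne_top (by simp)),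
        ENNReal.toReal_mul, ENNReal.toReal_ofReal hpi.le, inv_mul_eq_div]
      have : ((x : ℝ≥0∞) : EReal) = ((x : ℝ) : EReal) := rfl
      rw [this, EReal.coe_le_coe_iff, div_le_iff₀' hpi]
      rfl
  have h4 : ∫⁻ θ in Set.Ioc (0:ℝ) (2 * Real.pi), f θ = ⨆ m, I m := by
    rw [hI, ← lintegral_iSup]
    · congr 1; ext θ
      have : (⨆ m : ℕ, min (f θ) (m : ℝ≥0∞)) = f θ := by
        have := (inf_iSup_eq (f θ) (fun m : ℕ => (m : ℝ≥0∞))).symm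
        rw [ENNReal.iSup_natCast, inf_top_eq] at this
        exact this
      exact this.symm
    · exact fun m => hf.min measurable_const
    · intro m k hmk θ
      exact min_le_min le_rfl (by exact_mod_cast hmk)
  rw [h4, iSup_le_iff]
  exact forall_congr' h3

lemma negPsh_of_pshOn {u : E → EReal} {D : Set E} (hu : PshOn u D) (h0 : ∀ z ∈ D, u z ≤ 0) :
    NegPsh (fun z => (-u z).toENNReal) D := by
  have hl : LowerSemicontinuousOn (fun z => (-u z).toENNReal) D := by
    have hc : Continuous (fun x : EReal => (-x).toENNReal) :=
      EReal.continuous_toENNReal.comp continuous_neg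
    refine hc.comp_upperSemicontinuousOn_antitone hu.1 ?_
    intro x y hxy
    exact EReal.toENNReal_le_toENNReal (EReal.neg_le_neg_iff.2 hxy)
  refine ⟨hl, fun p b h => ?_⟩
  rw [← core_iff _ (lsc_circ hl h).measurable]
  intro m
  have hp : p ∈ D := by simpa using h 0 (by simp)
  have := (hu.2.2 p b).2 0 1 one_pos (by
    intro ζ hζ
    exact h ζ (by simpa using hζ)) m
  have e : ∀ z ∈ D, -(((-u z).toENNReal : ℝ≥0∞) : EReal) = u z := by
    intro z hz
    rw [EReal.coe_toENNReal, neg_neg]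
    exact EReal.neg_nonneg.2 (h0 z hz)
  simp only [zero_smul, add_zero] at this
  rw [e p hp]
  refine this.trans (le_of_eq ?_)
  unfold truncCircleAvg
  congr 2
  refine intervalIntegral.integral_congr fun θ _ => ?_
  have hz : circPt p b θ ∈ D := h _ (by rw [Complex.norm_exp_ofReal_mul_I])
  simp only
  rw [e _ hz]
  simp [circPt]

lemma NegPsh.pshOn {v : E → ℝ≥0∞} {D : Set E} (hv : NegPsh v D) :
    PshOn (fun z => -(v z : EReal)) D := by
  have hc : Continuous (fun x : ℝ≥0∞ => -(x : EReal)) :=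
    continuous_neg.comp continuous_coe_ennreal_ereal
  have hu : UpperSemicontinuousOn (fun z => -(v z : EReal)) D := by
    refine hc.comp_lowerSemicontinuousOn_antitone hv.1 ?_
    intro x y hxy
    exact EReal.neg_le_neg_iff.2 (EReal.coe_ennreal_le_coe_ennreal_iff.2 hxy)
  refine ⟨hu, fun z _ => by simp, fun a b => ⟨?_, ?_⟩⟩
  · refine hu.comp (g := fun ζ : ℂ => a + ζ • b) (by fun_prop) ?_
    intro ζ hζ; exact hζ
  · intro c r hr hsub
    have h : ∀ ζ : ℂ, ‖ζ‖ ≤ 1 → (a + c • b) + ζ • ((r : ℂ) • b) ∈ D := by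
      intro ζ hζ
      have : c + ζ * r ∈ Metric.closedBall c r := by
        simp only [mem_closedBall, dist_self_add_left, norm_mul, Complex.norm_real, Real.norm_eq_abs, abs_of_pos hr]
        nlinarith
      have := hsub this
      simp only [mem_ofPred_eq] at this
      rw [smul_smul, add_assoc, ← add_smul]; exact this
    have := (core_iff _ (lsc_circ hv.1 h).measurable (v (a + c • b))).2 (hv.2 _ _ h)
    intro m
    refine (this m).trans (le_of_eq ?_)
    unfold truncCircleAvg circPt
    simp only [smul_smul, add_assoc, ← add_smul, mul_comm]

lemma NegPsh.smul {v : E → ℝ≥0∞} {D : Set E} (hv : NegPsh v D) (c : ℝ≥0) :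
    NegPsh (fun z => (c : ℝ≥0∞) * v z) D := by
  refine ⟨?_, fun p b h => ?_⟩
  · refine (ENNReal.continuous_const_mul ENNReal.coe_ne_top).comp_lowerSemicontinuousOn hv.1 ?_
    intro x y h
    exact mul_le_mul_right h _
  · rw [lintegral_const_mul _ (lsc_circ hv.1 h).measurable, mul_left_comm]
    exact mul_le_mul_right (hv.2 p b h) _

lemma NegPsh.tsum {v : ℕ → E → ℝ≥0∞} {D : Set E} (hv : ∀ i, NegPsh (v i) D) :
    NegPsh (fun z => ∑' i, v i z) D := by
  refine ⟨lowerSemicontinuousOn_tsum fun i => (hv i).1, fun p b h => ?_⟩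
  rw [lintegral_tsum fun i => (lsc_circ (hv i).1 h).measurable.aemeasurable, ← ENNReal.tsum_mul_left]
  exact ENNReal.tsum_le_tsum fun i => (hv i).2 p b h

lemma NegPsh.min {v w : E → ℝ≥0∞} {D : Set E} (hv : NegPsh v D) (hw : NegPsh w D) :
    NegPsh (fun z => Min.min (v z) (w z)) D := by
  refine ⟨hv.1.inf hw.1, fun p b h => ?_⟩
  rcases le_total (v p) (w p) with hle | hle
  · simp only [min_eq_left hle]
    exact (lintegral_mono fun θ => min_le_left _ _).trans (hv.2 p b h)
  · simp only [min_eq_right hle]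
    exact (lintegral_mono fun θ => min_le_right _ _).trans (hw.2 p b h)

lemma NegPsh.one_add {v : E → ℝ≥0∞} {D : Set E} (hv : NegPsh v D) :
    NegPsh (fun z => 1 + v z) D := by
  refine ⟨?_, fun p b h => ?_⟩
  · refine (by fun_prop : Continuous fun x : ℝ≥0∞ => 1 + x).comp_lowerSemicontinuousOn hv.1 ?_
    intro x y h
    exact add_le_add_right h _
  · rw [lintegral_add_left measurable_const, mul_add]
    refine add_le_add ?_ (hv.2 p b h)
    simp

lemma NegPsh.eq_top_of_circ {v : E → ℝ≥0∞} {D V : Set E} (hv : NegPsh v D) (hV : IsOpen V)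
    (hVt : ∀ z ∈ V, v z = ⊤) {w p : E} (hw : w ∈ V)
    (h : ∀ ζ : ℂ, ‖ζ‖ ≤ 1 → p + ζ • (p - w) ∈ D) : v p = ⊤ := by
  by_contra hne
  have hpi := Real.pi_pos
  have hm := (lsc_circ hv.1 h).measurable
  have hfin : ∫⁻ θ in Set.Ioc (0:ℝ) (2 * Real.pi), v (circPt p (p - w) θ) ≠ ⊤ :=
    ne_top_of_le_ne_top (ENNReal.mul_ne_top ENNReal.ofReal_ne_top hne) (hv.2 _ _ h)
  have hae := ae_lt_top hm hfin
  set U : Set ℝ := circPt p (p - w) ⁻¹' V ∩ Set.Ioo 0 (2 * Real.pi) with hU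
  have hUo : IsOpen U := (hV.preimage (continuous_circPt _ _)).inter isOpen_Ioo
  have hUn : U.Nonempty := by
    refine ⟨Real.pi, ?_, hpi, by linarith⟩
    simp [circPt, hw]
  have hpos := hUo.measure_pos volume hUn
  rw [ae_iff] at hae
  have hle : volume U ≤ (volume.restrict (Set.Ioc (0:ℝ) (2 * Real.pi)))
      {a | ¬ v (circPt p (p - w) a) < ⊤} := by
    rw [Measure.restrict_apply' measurableSet_Ioc]
    refine measure_mono ?_
    rintro θ ⟨h1, h2⟩
    exact ⟨by simp [hVt _ h1], h2.1, h2.2.le⟩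
  rw [hae] at hle
  exact absurd hpos (not_lt.2 hle)

lemma NegPsh.exists_ne_top {v : E → ℝ≥0∞} {D W : Set E} (hv : NegPsh v D) (hD : IsOpen D)
    (hc : IsPreconnected D) (hne : ∃ z ∈ D, v z ≠ ⊤) (hW : IsOpen W) (hWD : (W ∩ D).Nonempty) :
    ∃ p ∈ W ∩ D, v p ≠ ⊤ := by
  by_contra hcon
  push Not at hcon
  set T : Set E := {z | v z = ⊤} ∩ D with hT
  have hsub : D ⊆ interior T := by
    refine hc.subset_of_closure_inter_subset isOpen_interior ?_ ?_
    · obtain ⟨x, hx⟩ := hWD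
      refine ⟨x, hx.2, ?_⟩
      exact interior_maximal (show W ∩ D ⊆ T from fun y hy => ⟨hcon y hy, hy.2⟩) (hW.inter hD) hx
    · rintro a ⟨ha, haD⟩
      obtain ⟨R, hR, hball⟩ := Metric.isOpen_iff.1 hD a haD
      obtain ⟨w, hw, hwa⟩ := Metric.mem_closure_iff.1 ha (R / 4) (by positivity)
      refine interior_maximal (s := T) (t := Metric.ball a (R / 4)) ?_ isOpen_ball
        (mem_ball_self (by positivity))
      intro p hp
      have hpa : ‖p - a‖ < R / 4 := by simpa [dist_eq_norm] using hp
      have hpw : ‖p - w‖ < R / 2 := by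
        have : ‖p - w‖ ≤ ‖p - a‖ + ‖a - w‖ := by
          simpa using norm_sub_le_norm_sub_add_norm_sub p a w
        rw [dist_eq_norm] at hwa
        linarith
      refine ⟨?_, hball (Metric.ball_subset_ball (by linarith) hp)⟩
      refine hv.eq_top_of_circ isOpen_interior (fun z hz => (interior_subset hz).1) hw ?_
      intro ζ hζ
      apply hball
      rw [mem_ball, dist_eq_norm]
      have e : p + ζ • (p - w) - a = (p - a) + ζ • (p - w) := by abel
      rw [e]
      have h1 := norm_add_le (p - a) (ζ • (p - w))
      rw [norm_smul] at h1
      have h2 : ‖ζ‖ * ‖p - w‖ ≤ 1 * ‖p - w‖ := by gcongr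
      linarith
  obtain ⟨z, hz, hzt⟩ := hne
  exact hzt (interior_subset (hsub hz)).1

lemma psh_max_principle [ProperSpace E] {D : Set E} (hD : IsOpen D)
    (hb : Bornology.IsBounded D) {F : E → ℝ} (hF : ContinuousOn F (closure D))
    (hpsh : PshOn (fun z => ((F z : ℝ) : EReal)) D) {z₀ : E} (hz₀ : z₀ ∈ frontier D)
    (h0 : ∀ x ∈ frontier D, F x ≤ 0) : ∀ x ∈ D, F x ≤ 0 := by
  intro x hx
  by_contra hxpos
  push Not at hxpos
  have hpi := Real.pi_pos
  have hK : IsCompact (closure D) := hb.isCompact_closure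
  obtain ⟨q₀, hq₀, hmax⟩ := hK.exists_isMaxOn ⟨x, subset_closure hx⟩ hF
  set M := F q₀ with hM
  have hmax' : ∀ y ∈ closure D, F y ≤ M := fun y hy => hmax hy
  have hS : IsCompact (closure D ∩ F ⁻¹' {M}) :=
    hK.of_isClosed_subset (hF.preimage_isClosed_of_isClosed isClosed_closure isClosed_singleton)
      inter_subset_left
  obtain ⟨q, ⟨hqc, hqM⟩, hqmax⟩ := hS.exists_isMaxOn ⟨q₀, hq₀, rfl⟩ continuous_norm.continuousOn
  have hqM : F q = M := hqM
  have hMpos : 0 < M := lt_of_lt_of_le hxpos (hmax' x (subset_closure hx))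
  have hqD : q ∈ D := by
    by_contra hq
    have : q ∈ frontier D := ⟨hqc, fun h => hq (interior_subset h)⟩
    have := h0 q this
    linarith
  have hz0D : z₀ ∉ D := by
    rw [hD.frontier_eq] at hz₀; exact hz₀.2
  obtain ⟨b, hb0, hbq⟩ : ∃ b : E, b ≠ 0 ∧ ∀ r : ℝ, 0 < r → ‖q‖ < ‖q + (r : ℂ) • b‖ := by
    by_cases h : q = 0
    · refine ⟨z₀, ?_, ?_⟩
      · rintro rfl; exact hz0D (h ▸ hqD)
      · intro r hr
        have : z₀ ≠ 0 := by rintro rfl; exact hz0D (h ▸ hqD)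
        rw [h, norm_zero, zero_add, norm_smul]
        have := norm_pos_iff.2 this
        have h2 : 0 < ‖(r : ℂ)‖ := by simp [hr.ne']
        positivity
    · refine ⟨q, h, fun r hr => ?_⟩
      have e : q + (r : ℂ) • q = ((1 + r : ℝ) : ℂ) • q := by
        push_cast; rw [add_smul, one_smul]
      rw [e, norm_smul, Complex.norm_real, Real.norm_eq_abs, abs_of_pos (by positivity)]
      have := norm_pos_iff.2 h
      nlinarith
  obtain ⟨R, hR, hball⟩ := Metric.isOpen_iff.1 hD q hqD
  have hbn := norm_pos_iff.2 hb0
  set r : ℝ := R / (2 * ‖b‖) with hr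
  have hrpos : 0 < r := by positivity
  have hin : ∀ ζ : ℂ, ‖ζ‖ ≤ r → q + ζ • b ∈ D := by
    intro ζ hζ
    apply hball
    rw [mem_ball, dist_self_add_left, norm_smul]
    calc ‖ζ‖ * ‖b‖ ≤ r * ‖b‖ := by gcongr
      _ = R / 2 := by rw [hr]; field_simp
      _ < R := by linarith
  have hcirc : ∀ θ : ℝ, q + ((r : ℂ) * Complex.exp (θ * Complex.I)) • b ∈ D := by
    intro θ
    apply hin
    rw [norm_mul, Complex.norm_exp_ofReal_mul_I, Complex.norm_real, Real.norm_eq_abs,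
      abs_of_pos hrpos, mul_one]
  obtain ⟨q₁, hq₁, hmin⟩ := hK.exists_isMinOn ⟨x, subset_closure hx⟩ hF
  obtain ⟨m, hm⟩ := exists_nat_ge (-F q₁)
  have hmin' : ∀ y ∈ closure D, -(m : ℝ) ≤ F y := fun y hy => by
    have : F q₁ ≤ F y := hmin hy
    linarith
  have key := (hpsh.2.2 q b).2 0 r hrpos (by
    intro ζ hζ
    exact hin ζ (by simpa using hζ)) m
  simp only [zero_smul, add_zero] at key
  rw [EReal.coe_le_coe_iff] at key
  unfold truncCircleAvg at key
  have e : ∀ θ : ℝ, (max ((F (q + (0 + (r : ℂ) * Complex.exp (θ * Complex.I)) • b) : ℝ) : EReal)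
      ((-(m : ℝ) : ℝ) : EReal)).toReal = F (q + ((r : ℂ) * Complex.exp (θ * Complex.I)) • b) := by
    intro θ
    rw [zero_add, max_eq_left, EReal.toReal_coe]
    exact EReal.coe_le_coe_iff.2 (hmin' _ (subset_closure (hcirc θ)))
  simp_rw [e] at key
  have hcont : Continuous (fun θ : ℝ => F (q + ((r : ℂ) * Complex.exp (θ * Complex.I)) • b)) := by
    rw [← continuousOn_univ]
    exact hF.comp (f := fun θ : ℝ => q + ((r : ℂ) * Complex.exp (θ * Complex.I)) • b)
      (by fun_prop) (fun θ _ => subset_closure (hcirc θ))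
  have hlt : (∫ θ in (0:ℝ)..(2 * Real.pi), F (q + ((r : ℂ) * Complex.exp (θ * Complex.I)) • b))
      < ∫ θ in (0:ℝ)..(2 * Real.pi), M := by
    refine intervalIntegral.integral_lt_integral_of_continuousOn_of_le_of_exists_lt (by positivity)
      hcont.continuousOn continuousOn_const (fun θ _ => hmax' _ (subset_closure (hcirc θ)))
      ⟨0, ⟨le_rfl, by positivity⟩, ?_⟩
    refine lt_of_le_of_ne (hmax' _ (subset_closure (hcirc 0))) ?_
    intro heq
    have h1 : ‖q + ((r : ℂ) * Complex.exp (((0 : ℝ) : ℂ) * Complex.I)) • b‖ ≤ ‖q‖ :=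
      hqmax (⟨subset_closure (hcirc 0), heq⟩ : _ ∈ closure D ∩ F ⁻¹' {M})
    have h2 := hbq r hrpos
    rw [Complex.ofReal_zero, zero_mul, Complex.exp_zero, mul_one] at h1
    linarith
  rw [intervalIntegral.integral_const, smul_eq_mul, sub_zero] at hlt
  rw [hqM, inv_mul_eq_div, le_div_iff₀ (by positivity)] at key
  linarith

lemma limsup_neg_tsum_eq_bot {v : ℕ → E → ℝ≥0∞} {l : Filter E}
    (h : ∀ᶠ i in atTop, ∀ᶠ z in l, 1 / 2 ≤ v i z) :
    limsup (fun z => -((1 + ∑' i, v i z : ℝ≥0∞) : EReal)) l = ⊥ := by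
  obtain ⟨j, hj⟩ := eventually_atTop.1 h
  have key : ∀ N : ℕ, limsup (fun z => -((1 + ∑' i, v i z : ℝ≥0∞) : EReal)) l
      ≤ -(((N : ℝ≥0∞) * (1 / 2) : ℝ≥0∞) : EReal) := by
    intro N
    refine limsup_le_of_le (by isBoundedDefault) ?_
    have : ∀ᶠ z in l, ∀ i ∈ Finset.Ico j (j + N), 1 / 2 ≤ v i z := by
      rw [Filter.eventually_all_finset]
      intro i hi
      exact hj i (Finset.mem_Ico.1 hi).1
    filter_upwards [this] with z hz
    rw [EReal.neg_le_neg_iff, EReal.coe_ennreal_le_coe_ennreal_iff]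
    refine le_add_left (le_trans ?_ (ENNReal.sum_le_tsum (Finset.Ico j (j + N))))
    have := Finset.card_nsmul_le_sum _ _ _ hz
    simpa using this
  rw [EReal.eq_bot_iff_forall_lt]
  intro y
  obtain ⟨N, hN⟩ := exists_nat_gt (-y * 2)
  refine (key N).trans_lt ?_
  have e : (((N : ℝ≥0∞) * (1 / 2) : ℝ≥0∞) : EReal) = (((N : ℝ) / 2 : ℝ) : EReal) := by
    rw [← EReal.coe_ennreal_toReal]
    · simp [div_eq_mul_inv]
    · exact ENNReal.mul_ne_top (by simp) (by simp)
  rw [e, ← EReal.coe_neg, EReal.coe_lt_coe_iff]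
  linarith

lemma eventually_le_of_uscReg {u : E → EReal} {D : Set E} {x : E} {c : ℝ≥0}
    (h : uscReg u D x < -((c : ℝ≥0∞) : EReal)) :
    ∀ᶠ z in 𝓝[D] x, (c : ℝ≥0∞) ≤ (-u z).toENNReal := by
  filter_upwards [eventually_lt_of_limsup_lt h (by isBoundedDefault)] with z hz
  have : ((c : ℝ≥0∞) : EReal) ≤ -u z := EReal.le_neg_of_le_neg hz.le
  have := EReal.toENNReal_le_toENNReal this
  rwa [EReal.toENNReal_coe] at this

lemma uscReg_neg_le {v : E → ℝ≥0∞} {D : Set E} {x : E} {c : ℝ≥0∞}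
    (h : ∀ᶠ z in 𝓝[D] x, c ≤ v z) : uscReg (fun z => -(v z : EReal)) D x ≤ -(c : EReal) := by
  refine limsup_le_of_le (by isBoundedDefault) ?_
  filter_upwards [h] with z hz
  exact EReal.neg_le_neg_iff.2 (EReal.coe_ennreal_le_coe_ennreal_iff.2 hz)

lemma le_uscReg_of_mem {u : E → EReal} {D : Set E} {x : E} (hx : x ∈ D) : u x ≤ uscReg u D x := by
  refine le_limsup_of_frequently_le ?_ (by isBoundedDefault)
  exact frequently_iff.2 fun {U} hU => ⟨x, mem_of_mem_nhdsWithin hx hU, le_rfl⟩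

/-- `A ∪ {ω < 0}` is contained in the hull (interior points). -/
lemma mem_bHull_of_bndExt_neg {D A : Set E} {z : E} (hz : z ∈ D) (hω : bndExt z A D < 0) :
    z ∈ bHull A D := by
  refine ⟨subset_closure hz, fun u hu hneg hne hA => ?_⟩
  have hv := negPsh_of_pshOn hu (fun y hy => (hneg y hy).le)
  have hbot : u z = ⊥ := by
    by_contra hzne
    have hvz : (-u z).toENNReal ≠ ⊤ := by
      rw [EReal.toENNReal_ne_top_iff]
      intro h; exact hzne (EReal.neg_eq_top_iff.1 h)
    have ht : (-bndExt z A D).toENNReal ≠ 0 := by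
      rw [EReal.toENNReal_ne_zero_iff]
      rw [EReal.lt_neg_comm]; simpa using hω
    obtain ⟨ε, hε, hlt⟩ := ENNReal.exists_nnreal_pos_mul_lt hvz ht
    have hmem : -((ε * (-u z).toENNReal : ℝ≥0∞) : EReal) ≤ bndExt z A D := by
      refine le_sSup ⟨fun y => -((ε * (-u y).toENNReal : ℝ≥0∞) : EReal),
        ⟨(hv.smul ε).pshOn, ?_⟩, ?_, ?_, rfl⟩
      · refine ⟨z, hz, ?_⟩
        rw [Ne, EReal.neg_eq_bot_iff, EReal.coe_ennreal_eq_top_iff]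
        exact ENNReal.mul_ne_top ENNReal.coe_ne_top hvz
      · intro y _
        rw [EReal.neg_le, neg_zero]
        exact EReal.coe_ennreal_nonneg _
      · intro x hx
        have h1 : ∀ᶠ y in 𝓝[D] x, ((ε⁻¹ : ℝ≥0) : ℝ≥0∞) ≤ (-u y).toENNReal := by
          apply eventually_le_of_uscReg
          rw [hA x hx, bot_lt_iff_ne_bot, Ne, EReal.neg_eq_bot_iff, EReal.coe_ennreal_eq_top_iff]
          exact ENNReal.coe_ne_top
        have h2 : ∀ᶠ y in 𝓝[D] x, (1 : ℝ≥0∞) ≤ ε * (-u y).toENNReal := by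
          filter_upwards [h1] with y hy
          calc (1 : ℝ≥0∞) = ε * ((ε⁻¹ : ℝ≥0) : ℝ≥0∞) := by
                rw [← ENNReal.coe_mul, mul_inv_cancel₀ hε.ne', ENNReal.coe_one]
            _ ≤ _ := by gcongr
        have := uscReg_neg_le h2
        simpa using this
    have h3 := EReal.toENNReal_le_toENNReal (EReal.neg_le_neg_iff.2 hmem)
    rw [neg_neg, EReal.toENNReal_coe] at h3
    exact absurd hlt (not_lt.2 h3)
  rw [eq_bot_iff, ← hbot]
  have := hu.1 z hz
  refine le_of_forall_gt_imp_ge_of_dense fun y hy => ?_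
  exact limsup_le_of_le (by isBoundedDefault) ((this y hy).mono fun _ h => le_of_lt h)

lemma bndExt_neg_of_mem_bHull {D A : Set E} {z : E} (hz : z ∈ D) (hh : z ∈ bHull A D) :
    bndExt z A D < 0 := by
  by_contra hcon
  push Not at hcon
  have hex : ∀ i : ℕ, ∃ u : E → EReal, MemPSH u D ∧ (∀ y ∈ D, u y ≤ 0) ∧
      (∀ x ∈ A, uscReg u D x ≤ -1) ∧ -(((1 / 2 : ℝ≥0∞) ^ i : ℝ≥0∞) : EReal) < u z := by
    intro i
    have : -(((1 / 2 : ℝ≥0∞) ^ i : ℝ≥0∞) : EReal) < bndExt z A D := by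
      refine lt_of_lt_of_le ?_ hcon
      rw [EReal.neg_lt_comm, neg_zero, EReal.coe_ennreal_pos]
      exact ENNReal.pow_pos (by simp) _
    obtain ⟨w, ⟨u, h1, h2, h3, rfl⟩, hw⟩ := lt_sSup_iff.1 this
    exact ⟨u, h1, h2, h3, hw⟩
  choose u hu1 hu2 hu3 hu4 using hex
  have hv : ∀ i, NegPsh (fun y => (-u i y).toENNReal) D :=
    fun i => negPsh_of_pshOn (hu1 i).1 (hu2 i)
  have hs := (NegPsh.tsum hv).one_add
  have hfin : (1 + ∑' i, (-u i z).toENNReal : ℝ≥0∞) ≠ ⊤ := by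
    refine ENNReal.add_ne_top.2 ⟨by simp, ?_⟩
    refine ne_top_of_le_ne_top ?_ (ENNReal.tsum_le_tsum (g := fun i => (1 / 2 : ℝ≥0∞) ^ i) ?_)
    · rw [ENNReal.tsum_geometric]; simp
    · intro i
      have := EReal.toENNReal_le_toENNReal (EReal.neg_le_of_neg_le (hu4 i).le)
      rwa [EReal.toENNReal_coe] at this
  have hne : -((1 + ∑' i, (-u i z).toENNReal : ℝ≥0∞) : EReal) ≠ ⊥ := by
    rw [Ne, EReal.neg_eq_bot_iff, EReal.coe_ennreal_eq_top_iff]; exact hfin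
  have := hh.2 _ hs.pshOn ?_ ⟨z, hz, hne⟩ ?_
  · have h := le_uscReg_of_mem (u := fun y => -((1 + ∑' i, (-u i y).toENNReal : ℝ≥0∞) : EReal)) hz
    rw [this, le_bot_iff] at h
    exact hne h
  · intro y _
    rw [EReal.neg_lt_comm, neg_zero, EReal.coe_ennreal_pos]
    exact lt_of_lt_of_le zero_lt_one le_self_add
  · intro x hx
    refine limsup_neg_tsum_eq_bot (v := fun i y => (-u i y).toENNReal)
      (Eventually.of_forall fun i => ?_)
    have h := eventually_le_of_uscReg (u := u i) (D := D) (x := x) (c := 1 / 2) ?_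
    · filter_upwards [h] with y hy
      simpa using hy
    · refine lt_of_le_of_lt (hu3 i x hx) ?_
      rw [EReal.neg_lt_neg_iff, ← EReal.coe_ennreal_one, EReal.coe_ennreal_lt_coe_ennreal_iff]
      rw [← ENNReal.coe_one, ENNReal.coe_lt_coe]
      exact half_lt_self one_pos

lemma mem_of_mem_bHull_frontier [ProperSpace E] {D A : Set E} (hD : IsBddDomain D)
    (hreg : BRegular D) (hA : A ⊆ frontier D) (hbp : BPluripolar A D)
    {z : E} (hz : z ∈ frontier D) (hh : z ∈ bHull A D) : z ∈ A := by
  by_contra hzA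
  obtain ⟨hDo, hDc, hDb⟩ := hD
  obtain ⟨u, hu, hu0, ⟨z₁, hz₁, hz₁ne⟩, huA⟩ := hbp
  obtain ⟨F, hFc, hFp, hFb⟩ := hreg (fun x => -dist x z) (by fun_prop)
  have hF0 : ∀ x ∈ D, F x ≤ 0 := psh_max_principle hDo hDb hFc hFp hz (fun x hx => by
    rw [hFb x hx]; simp)
  have hv := negPsh_of_pshOn hu hu0
  have hg := negPsh_of_pshOn hFp (fun x hx => by
    rw [← EReal.coe_zero, EReal.coe_le_coe_iff]; exact hF0 x hx)
  have hgeq : (fun y => (-((F y : ℝ) : EReal)).toENNReal) = fun y => ENNReal.ofReal (-F y) := by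
    ext y; rw [← EReal.coe_neg, EReal.real_coe_toENNReal]
  rw [hgeq] at hg
  set v : E → ℝ≥0∞ := fun y => (-u y).toENNReal with hvdef
  set g : E → ℝ≥0∞ := fun y => ENNReal.ofReal (-F y) with hgdef
  have hvne : ∃ y ∈ D, v y ≠ ⊤ := ⟨z₁, hz₁, by
    rw [hvdef, EReal.toENNReal_ne_top_iff]
    intro h; exact hz₁ne (EReal.neg_eq_top_iff.1 h)⟩
  have hzc : z ∈ closure D := frontier_subset_closure hz
  -- the sequence of points
  have hp : ∀ k : ℕ, ∃ p ∈ D, dist p z < 1 / ((k : ℝ) + 1) ∧ (k : ℝ≥0∞) * k * g p ≤ 1 ∧ v p ≠ ⊤ := by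
    intro k
    have hcw : ContinuousWithinAt F D z := (hFc z hzc).mono subset_closure
    have hFz : F z = 0 := by rw [hFb z hz]; simp
    have h1 : ∀ᶠ y in 𝓝[D] z, -(1 / (((k : ℝ) + 1) * (k + 1))) < F y := by
      refine hcw.eventually (lt_mem_nhds ?_)
      rw [hFz]
      have : 0 < 1 / (((k : ℝ) + 1) * (k + 1)) := by positivity
      linarith
    obtain ⟨W, hWo, hzW, hW⟩ := mem_nhdsWithin.1 h1
    have hWn : IsOpen (W ∩ Metric.ball z (1 / ((k : ℝ) + 1))) := hWo.inter isOpen_ball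
    have hzW' : z ∈ W ∩ Metric.ball z (1 / ((k : ℝ) + 1)) := ⟨hzW, mem_ball_self (by positivity)⟩
    obtain ⟨p, ⟨⟨hpW, hpb⟩, hpD⟩, hpv⟩ := hv.exists_ne_top hDo hDc.isPreconnected hvne hWn
      (mem_closure_iff.1 hzc _ hWn hzW')
    refine ⟨p, hpD, hpb, ?_, hpv⟩
    have h2 : -(1 / (((k : ℝ) + 1) * (k + 1))) < F p := hW ⟨hpW, hpD⟩
    have h3 : -F p ≤ 1 / (((k : ℝ) + 1) * (k + 1)) := by linarith
    have h0 := hF0 p hpD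
    have e : (k : ℝ≥0∞) * k * g p = ENNReal.ofReal ((k : ℝ) * k * -F p) := by
      rw [ENNReal.ofReal_mul (by positivity), ENNReal.ofReal_mul (by positivity),
        ENNReal.ofReal_natCast]
    rw [e, ENNReal.ofReal_le_one]
    rw [le_div_iff₀ (by positivity)] at h3
    have hk : (0 : ℝ) ≤ k := Nat.cast_nonneg k
    nlinarith
  choose p hpD hpz hpg hpv using hp
  -- the scaling factors
  have hε : ∀ i : ℕ, ∃ ε : ℝ≥0, 0 < ε ∧ ∀ k ≤ i, (ε : ℝ≥0∞) * v (p k) ≤ (1 / 2) ^ i := by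
    intro i
    obtain ⟨ε, h1, h2⟩ := ENNReal.exists_nnreal_pos_mul_lt
      (a := ∑ k ∈ Finset.range (i + 1), v (p k)) (b := (1 / 2) ^ i)
      (ENNReal.sum_ne_top.2 fun k _ => hpv k) (ENNReal.pow_pos (by simp) i).ne'
    refine ⟨ε, h1, fun k hk => le_trans ?_ h2.le⟩
    gcongr
    exact Finset.single_le_sum (f := fun k => v (p k)) (fun _ _ => zero_le)
      (Finset.mem_range.2 (by omega))
  choose ε hε0 hε1 using hε
  set w : ℕ → E → ℝ≥0∞ := fun i y => min ((ε i : ℝ≥0∞) * v y) (((i : ℝ≥0) : ℝ≥0∞) * g y) with hw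
  have hwN : ∀ i, NegPsh (w i) D := fun i => (hv.smul (ε i)).min (hg.smul (i : ℝ≥0))
  have hs := (NegPsh.tsum hwN).one_add
  have hbd : ∀ k, (1 + ∑' i, w i (p k)) ≤ 4 := by
    intro k
    have h1 : ∀ i, w i (p k) ≤ (1 / 2) ^ i + (if i ∈ Finset.range k then (k : ℝ≥0∞) * g (p k) else 0) := by
      intro i
      by_cases hik : i < k
      · rw [if_pos (Finset.mem_range.2 hik)]
        refine (min_le_right _ _).trans (le_add_left ?_)
        gcongr
        exact_mod_cast hik.le
      · rw [if_neg (by simpa using hik), add_zero]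
        exact (min_le_left _ _).trans (hε1 i k (not_lt.1 hik))
    have h2 : ∑' i, (if i ∈ Finset.range k then (k : ℝ≥0∞) * g (p k) else 0) ≤ 1 := by
      rw [tsum_eq_sum (s := Finset.range k) (fun i hi => if_neg hi), Finset.sum_congr rfl
        (fun i hi => if_pos hi)]
      simp only [Finset.sum_const, Finset.card_range, nsmul_eq_mul]
      rw [← mul_assoc]; exact hpg k
    calc 1 + ∑' i, w i (p k) ≤ 1 + (∑' i, (1 / 2 : ℝ≥0∞) ^ i
          + ∑' i, (if i ∈ Finset.range k then (k : ℝ≥0∞) * g (p k) else 0)) := by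
          rw [← ENNReal.tsum_add]
          gcongr with i
          exact h1 i
      _ ≤ 1 + (2 + 1) := by
          gcongr
          rw [ENNReal.tsum_geometric]
          simp
      _ = 4 := by norm_num
  have hptend : Tendsto p atTop (𝓝[D] z) := by
    rw [tendsto_nhdsWithin_iff]
    refine ⟨?_, Eventually.of_forall hpD⟩
    rw [tendsto_iff_dist_tendsto_zero]
    exact squeeze_zero (fun _ => dist_nonneg) (fun k => (hpz k).le)
      tendsto_one_div_add_atTop_nhds_zero_nat
  have hge : ∀ k, -((4 : ℝ≥0∞) : EReal) ≤ -((1 + ∑' i, w i (p k) : ℝ≥0∞) : EReal) := fun k =>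
    EReal.neg_le_neg_iff.2 (EReal.coe_ennreal_le_coe_ennreal_iff.2 (hbd k))
  have h4 : -((4 : ℝ≥0∞) : EReal) ≠ ⊥ := by
    rw [Ne, EReal.neg_eq_bot_iff, EReal.coe_ennreal_eq_top_iff]; simp
  have := hh.2 _ hs.pshOn ?_ ⟨p 0, hpD 0, fun h => h4 (le_bot_iff.1 ((hge 0).trans h.le))⟩ ?_
  · have h : -((4 : ℝ≥0∞) : EReal) ≤
        uscReg (fun y => -((1 + ∑' i, w i y : ℝ≥0∞) : EReal)) D z := by
      refine le_limsup_of_frequently_le ?_ (by isBoundedDefault)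
      exact hptend.frequently (Frequently.of_forall hge)
    rw [this, le_bot_iff] at h
    exact h4 h
  · intro y _
    rw [EReal.neg_lt_comm, neg_zero, EReal.coe_ennreal_pos]
    exact lt_of_lt_of_le zero_lt_one le_self_add
  · intro x hx
    refine limsup_neg_tsum_eq_bot (v := w) ?_
    have hxf := hA hx
    have hxz : 0 < dist x z := dist_pos.2 (fun h => hzA (h ▸ hx))
    obtain ⟨j, hj⟩ := exists_nat_gt (1 / dist x z)
    rw [div_lt_iff₀ hxz] at hj
    filter_upwards [eventually_ge_atTop j] with i hi
    have hij : (j : ℝ) ≤ i := by exact_mod_cast hi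
    have h1 : ∀ᶠ y in 𝓝[D] x, (((2 * ε i)⁻¹ : ℝ≥0) : ℝ≥0∞) ≤ v y := by
      apply eventually_le_of_uscReg
      rw [huA x hx, bot_lt_iff_ne_bot, Ne, EReal.neg_eq_bot_iff, EReal.coe_ennreal_eq_top_iff]
      exact ENNReal.coe_ne_top
    have hcw : ContinuousWithinAt F D x := (hFc x (frontier_subset_closure hxf)).mono subset_closure
    have h2 : ∀ᶠ y in 𝓝[D] x, F y < -(dist x z / 2) := by
      refine hcw.eventually (gt_mem_nhds ?_)
      rw [hFb x hxf]; linarith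
    filter_upwards [h1, h2] with y hy1 hy2
    refine le_min ?_ ?_
    · calc (1 / 2 : ℝ≥0∞) = ε i * (((2 * ε i)⁻¹ : ℝ≥0) : ℝ≥0∞) := by
            have h5 : ε i * (2 * ε i)⁻¹ = 1 / 2 := by
              have := (hε0 i).ne'
              field_simp
            rw [← ENNReal.coe_mul, h5]; simp
        _ ≤ _ := by gcongr
    · have e : ((i : ℝ≥0) : ℝ≥0∞) * g y = ENNReal.ofReal ((i : ℝ) * -F y) := by
        rw [ENNReal.ofReal_mul (by positivity), ENNReal.ofReal_natCast]; simp [hgdef]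
      rw [e]
      have : (1 / 2 : ℝ≥0∞) = ENNReal.ofReal (1 / 2) := by
        rw [ENNReal.ofReal_div_of_pos (by norm_num)]; simp
      rw [this]
      apply ENNReal.ofReal_le_ofReal
      nlinarith

end aux

/-- If `D` is B-regular and `A ⊆ ∂D` is b-pluripolar, then
`Â = A ∪ {z ∈ D : ω(z, A, D) < 0}`. -/
theorem bHull_eq_union {n : ℕ}
    (D A : Set (EuclideanSpace ℂ (Fin n))) (hD : IsBddDomain D)
    (hreg : BRegular D) (hA : A ⊆ frontier D) (hbp : BPluripolar A D) :
    bHull A D = A ∪ {z ∈ D | bndExt z A D < 0} := by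
  refine Set.Subset.antisymm ?_ ?_
  · intro z hz
    by_cases hzD : z ∈ D
    · exact Or.inr ⟨hzD, bndExt_neg_of_mem_bHull hzD hz⟩
    · have hzf : z ∈ frontier D := ⟨hz.1, fun h => hzD (interior_subset h)⟩
      exact Or.inl (mem_of_mem_bHull_frontier hD hreg hA hbp hzf hz)
  · rintro z (hz | ⟨hz, hω⟩)
    · exact ⟨frontier_subset_closure (hA hz), fun u _ _ _ h => h z hz⟩
    · exact mem_bHull_of_bndExt_neg hz hω
end

section
/- Let D be a bounded domain in ℂⁿ, let A ⊆ ∂D be b-pluripolar, and let K ⊆ ∂D \ A be compact. Then there exists a set L ⊆ D \ Â such that K is contained in the closure of L and L ∪ K is compact. -/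
open Complex Metric MeasureTheory Filter Topology Set

variable {F : Type*} [NormedAddCommGroup F] [NormedSpace ℂ F]

/-- Integrability of truncations along circles. -/
lemma trunc_intervalIntegrable {u : ℂ → EReal} {U : Set ℂ} (hu : UpperSemicontinuousOn u U)
    (hneg : ∀ z ∈ U, u z ≤ 0) {c : ℂ} {r : ℝ} (hr : 0 < r) (hU : closedBall c r ⊆ U)
    (m : ℕ) (a b : ℝ) :
    IntervalIntegrable (fun θ : ℝ =>
      (max (u (c + (r : ℂ) * Complex.exp (θ * Complex.I))) ((-(m : ℝ) : ℝ) : EReal)).toReal)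
      volume a b := by
  have hmem : ∀ θ : ℝ, c + (r : ℂ) * Complex.exp (θ * Complex.I) ∈ U := by
    intro θ
    apply hU
    simp [Complex.norm_exp_ofReal_mul_I, abs_of_pos hr]
  have husc : UpperSemicontinuous
      (fun θ : ℝ => u (c + (r : ℂ) * Complex.exp (θ * Complex.I))) := by
    have hc : Continuous (fun θ : ℝ => c + (r : ℂ) * Complex.exp (θ * Complex.I)) := by fun_prop
    intro θ y hy
    have h1 := hu _ (hmem θ) y hy
    have h2 : Tendsto (fun θ : ℝ => c + (r : ℂ) * Complex.exp (θ * Complex.I)) (𝓝 θ)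
        (𝓝[U] (c + (r : ℂ) * Complex.exp (θ * Complex.I))) :=
      tendsto_nhdsWithin_iff.2 ⟨hc.tendsto θ, Eventually.of_forall hmem⟩
    exact h2.eventually h1
  have hmeas : Measurable (fun θ : ℝ =>
      (max (u (c + (r : ℂ) * Complex.exp (θ * Complex.I))) ((-(m : ℝ) : ℝ) : EReal)).toReal) :=
    (husc.measurable.max measurable_const).ereal_toReal
  refine IntervalIntegrable.mono_fun (f := fun _ => (m : ℝ)) intervalIntegrable_const
    hmeas.aestronglyMeasurable (Eventually.of_forall fun θ => ?_)
  have hle : max (u (c + (r : ℂ) * Complex.exp (θ * Complex.I))) ((-(m : ℝ) : ℝ) : EReal)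
      ≤ ((0 : ℝ) : EReal) := by
    apply max_le
    · exact_mod_cast hneg _ (hmem θ)
    · exact EReal.coe_le_coe_iff.2 (by simp)
  have hge : ((-(m : ℝ) : ℝ) : EReal) ≤
      max (u (c + (r : ℂ) * Complex.exp (θ * Complex.I))) ((-(m : ℝ) : ℝ) : EReal) :=
    le_max_right _ _
  have h1 := EReal.toReal_le_toReal hle (ne_of_gt (lt_of_lt_of_le (EReal.bot_lt_coe _) hge))
    (EReal.coe_ne_top _)
  have h2 := EReal.toReal_le_toReal hge (EReal.coe_ne_bot _)
    (ne_of_lt (lt_of_le_of_lt hle (EReal.coe_lt_top _)))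
  rw [EReal.toReal_coe] at h1 h2
  beta_reduce
  rw [Real.norm_eq_abs, Real.norm_eq_abs, abs_of_nonpos h1, Nat.abs_cast]
  linarith

/-- If a nonpositive subharmonic function is `-∞` near one point of a circle, it is `-∞` at the
centre. -/
lemma center_eq_bot {u : ℂ → EReal} {U : Set ℂ} (hu : SubharmonicOn u U)
    (hneg : ∀ z ∈ U, u z ≤ 0) (hU : closedBall (0 : ℂ) 1 ⊆ U)
    (h1 : ∀ᶠ z in 𝓝 (1 : ℂ), u z = ⊥) : u 0 = ⊥ := by
  have hc : Continuous (fun θ : ℝ => (0 : ℂ) + ((1 : ℝ) : ℂ) * Complex.exp (θ * Complex.I)) := by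
    fun_prop
  have hev : ∀ᶠ θ : ℝ in 𝓝 0, u ((0 : ℂ) + ((1 : ℝ) : ℂ) * Complex.exp (θ * Complex.I)) = ⊥ := by
    have := hc.tendsto 0
    simp only [Complex.ofReal_zero, zero_mul, Complex.exp_zero, Complex.ofReal_one, mul_one,
      zero_add] at this
    have h3 := this.eventually h1
    simpa using h3
  obtain ⟨ε, hε, hball⟩ := Metric.eventually_nhds_iff.1 hev
  obtain ⟨δ, hδ0, hδε, hδπ⟩ : ∃ δ : ℝ, 0 < δ ∧ δ < ε ∧ δ ≤ 2 * Real.pi := by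
    refine ⟨min (ε / 2) (2 * Real.pi), lt_min (by linarith) Real.two_pi_pos, ?_, min_le_right _ _⟩
    exact lt_of_le_of_lt (min_le_left _ _) (by linarith)
  have key : ∀ m : ℕ, u 0 ≤ (((2 * Real.pi)⁻¹ * (-(δ * m)) : ℝ) : EReal) := by
    intro m
    refine (hu.2 0 1 one_pos hU m).trans (EReal.coe_le_coe_iff.2 ?_)
    unfold truncCircleAvg
    have hi := trunc_intervalIntegrable hu.1 hneg one_pos hU m
    apply mul_le_mul_of_nonneg_left _ (by positivity)
    rw [← intervalIntegral.integral_add_adjacent_intervals (hi 0 δ) (hi δ (2 * Real.pi))]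
    have e1 : ∫ θ in (0:ℝ)..δ, (max (u ((0 : ℂ) + ((1 : ℝ) : ℂ) * Complex.exp (θ * Complex.I)))
        ((-(m : ℝ) : ℝ) : EReal)).toReal = ∫ θ in (0:ℝ)..δ, (-(m : ℝ)) := by
      apply intervalIntegral.integral_congr
      intro θ hθ
      rw [uIcc_of_le hδ0.le] at hθ
      have : u ((0 : ℂ) + ((1 : ℝ) : ℂ) * Complex.exp (θ * Complex.I)) = ⊥ := by
        apply hball
        rw [Real.dist_eq, sub_zero, abs_of_nonneg hθ.1]
        linarith [hθ.2]
      simp only [this]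
      rw [max_eq_right bot_le, EReal.toReal_coe]
    have e2 : ∫ θ in δ..(2 * Real.pi),
        (max (u ((0 : ℂ) + ((1 : ℝ) : ℂ) * Complex.exp (θ * Complex.I)))
        ((-(m : ℝ) : ℝ) : EReal)).toReal ≤ ∫ θ in δ..(2 * Real.pi), (0 : ℝ) := by
      apply intervalIntegral.integral_mono_on hδπ (hi _ _) intervalIntegrable_const
      intro θ _
      apply EReal.toReal_nonpos
      apply max_le
      · apply hneg
        apply hU
        simp [Complex.norm_exp_ofReal_mul_I]
      · exact_mod_cast (by simp : (-(m : ℝ)) ≤ 0)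
    rw [e1]
    simp only [intervalIntegral.integral_const, smul_eq_mul, mul_zero] at e2 ⊢
    linarith
  rw [EReal.eq_bot_iff_forall_lt]
  intro y
  obtain ⟨m, hm⟩ := exists_nat_gt (-y / ((2 * Real.pi)⁻¹ * δ))
  refine (key m).trans_lt (EReal.coe_lt_coe_iff.2 ?_)
  have hp : 0 < (2 * Real.pi)⁻¹ * δ := by positivity
  rw [div_lt_iff₀ hp] at hm
  linarith

/-- The set where a nonpositive psh function is finite is dense in the domain. -/
lemma subset_closure_ne_bot {D : Set F} (hDo : IsOpen D) (hDc : IsPreconnected D) {u : F → EReal}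
    (hu : PshOn u D) (hneg : ∀ z ∈ D, u z ≤ 0) (hne : ∃ z ∈ D, u z ≠ ⊥) :
    D ⊆ closure {z ∈ D | u z ≠ ⊥} := by
  by_contra hcon
  obtain ⟨x, hxD, hx⟩ := not_subset.1 hcon
  set W : Set F := interior {z ∈ D | u z = ⊥} with hW
  have hxW : x ∈ W := by
    rw [hW, mem_interior_iff_mem_nhds]
    filter_upwards [isClosed_closure.isOpen_compl.mem_nhds hx, hDo.mem_nhds hxD] with z hz hzD
    refine ⟨hzD, ?_⟩
    by_contra h
    exact hz (subset_closure ⟨hzD, h⟩)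
  have hsub : D ⊆ W := by
    refine hDc.subset_of_closure_inter_subset isOpen_interior ⟨x, hxD, hxW⟩ ?_
    rintro z ⟨hzc, hzD⟩
    obtain ⟨ε, hε, hb⟩ := Metric.isOpen_iff.1 hDo z hzD
    obtain ⟨w, hwW, hw⟩ := Metric.mem_closure_iff.1 hzc (ε / 4) (by linarith)
    rw [hW, mem_interior_iff_mem_nhds]
    filter_upwards [Metric.ball_mem_nhds z (show 0 < ε / 4 by linarith)] with p hp
    have hp' : dist p z < ε / 4 := hp
    refine ⟨hb (Metric.ball_subset_ball (by linarith) hp), ?_⟩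
    have hs := hu.2.2 p (w - p)
    have hr := center_eq_bot hs (fun ζ hζ => hneg _ hζ) ?_ ?_
    · simpa using hr
    · intro ζ hζ
      apply hb
      have hζ' : ‖ζ‖ ≤ 1 := by simpa using hζ
      have hwp : ‖w - p‖ < ε / 2 := by
        rw [← dist_eq_norm]
        have := dist_triangle w z p
        rw [dist_comm w z, dist_comm z p] at this
        linarith
      rw [mem_ball, dist_eq_norm]
      calc ‖p + ζ • (w - p) - z‖ = ‖(p - z) + ζ • (w - p)‖ := by congr 1; abel
        _ ≤ ‖p - z‖ + ‖ζ‖ * ‖w - p‖ := (norm_add_le _ _).trans (by rw [norm_smul])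
        _ ≤ ‖p - z‖ + 1 * ‖w - p‖ := by gcongr
        _ < ε := by rw [← dist_eq_norm]; linarith
    · have hc : Continuous (fun ζ : ℂ => p + ζ • (w - p)) := by fun_prop
      have := hc.tendsto 1
      simp only [one_smul, add_sub_cancel] at this
      have h2 := this.eventually (mem_interior_iff_mem_nhds.1 hwW)
      exact h2.mono fun _ h => h.2
  obtain ⟨z, hzD, hz⟩ := hne
  exact hz (interior_subset (hsub hzD)).2

lemma mono_add_neg_one : Monotone (fun x : EReal => x + ((-1 : ℝ) : EReal)) :=
  fun _ _ h => add_le_add_left h _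

lemma cont_add_neg_one : Continuous (fun x : EReal => x + ((-1 : ℝ) : EReal)) := by
  rw [continuous_iff_continuousAt]
  intro x
  have h := EReal.continuousAt_add (p := (x, ((-1 : ℝ) : EReal))) (Or.inr (EReal.coe_ne_bot _))
    (Or.inr (EReal.coe_ne_top _))
  exact ContinuousAt.comp (f := fun x : EReal => (x, ((-1 : ℝ) : EReal))) h (by fun_prop)

lemma add_neg_one_le (x : EReal) : x + ((-1 : ℝ) : EReal) ≤ x := by
  calc x + ((-1 : ℝ) : EReal) ≤ x + ((0 : ℝ) : EReal) :=
        add_le_add_right (EReal.coe_le_coe_iff.2 (by norm_num)) _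
    _ = x := by simp

lemma subharmonic_sub_one {u : ℂ → EReal} {U : Set ℂ} (hu : SubharmonicOn u U)
    (hneg : ∀ z ∈ U, u z ≤ 0) : SubharmonicOn (fun z => u z + ((-1 : ℝ) : EReal)) U := by
  refine ⟨cont_add_neg_one.comp_upperSemicontinuousOn hu.1 mono_add_neg_one, ?_⟩
  intro c r hr hU m
  have hmem : ∀ θ : ℝ, c + (r : ℂ) * Complex.exp (θ * Complex.I) ∈ U := by
    intro θ
    apply hU
    simp [Complex.norm_exp_ofReal_mul_I, abs_of_pos hr]
  cases m with
  | zero =>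
    have h0 : truncCircleAvg (fun z => u z + ((-1 : ℝ) : EReal)) c r 0 = 0 := by
      unfold truncCircleAvg
      have : ∀ θ : ℝ, (max (u (c + (r : ℂ) * Complex.exp (θ * Complex.I)) + ((-1 : ℝ) : EReal))
          ((-((0 : ℕ) : ℝ) : ℝ) : EReal)).toReal = 0 := by
        intro θ
        rw [max_eq_right]
        · simp
        · simpa using (add_neg_one_le _).trans (hneg _ (hmem θ))
      simp only [this]
      simp
    rw [h0]
    exact_mod_cast (add_neg_one_le _).trans (hneg c (hU (mem_closedBall_self hr.le)))
  | succ k =>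
    have h1 : truncCircleAvg (fun z => u z + ((-1 : ℝ) : EReal)) c r (k + 1)
        = truncCircleAvg u c r k + (-1) := by
      unfold truncCircleAvg
      have : ∀ θ : ℝ, (max (u (c + (r : ℂ) * Complex.exp (θ * Complex.I)) + ((-1 : ℝ) : EReal))
          ((-((k + 1 : ℕ) : ℝ) : ℝ) : EReal)).toReal =
          (max (u (c + (r : ℂ) * Complex.exp (θ * Complex.I))) ((-(k : ℝ) : ℝ) : EReal)).toReal
            + (-1) := by
        intro θ
        have e : ((-((k + 1 : ℕ) : ℝ) : ℝ) : EReal)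
            = ((-(k : ℝ) : ℝ) : EReal) + ((-1 : ℝ) : EReal) := by
          rw [← EReal.coe_add]
          congr 1
          push_cast
          ring
        rw [e, ← mono_add_neg_one.map_max, EReal.toReal_add]
        · simp
        · apply ne_of_lt
          apply max_lt
          · exact lt_of_le_of_lt (hneg _ (hmem θ)) EReal.zero_lt_top
          · exact EReal.coe_lt_top _
        · exact ne_of_gt (lt_of_lt_of_le (EReal.bot_lt_coe _) (le_max_right _ _))
        · exact EReal.coe_ne_top _
        · exact EReal.coe_ne_bot _
      simp only [this]
      rw [intervalIntegral.integral_add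
        (trunc_intervalIntegrable hu.1 hneg hr hU k _ _) intervalIntegrable_const]
      have := Real.pi_pos
      simp only [intervalIntegral.integral_const, smul_eq_mul]
      rw [mul_add]
      congr 1
      field_simp
      ring
    rw [h1, EReal.coe_add]
    exact mono_add_neg_one (hu.2 c r hr hU k)

lemma psh_sub_one {D : Set F} {u : F → EReal} (hu : PshOn u D) (hneg : ∀ z ∈ D, u z ≤ 0) :
    PshOn (fun z => u z + ((-1 : ℝ) : EReal)) D := by
  refine ⟨cont_add_neg_one.comp_upperSemicontinuousOn hu.1 mono_add_neg_one, ?_, ?_⟩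
  · intro z hz
    exact ne_of_lt (lt_of_le_of_lt ((add_neg_one_le _).trans (hneg z hz)) EReal.zero_lt_top)
  · intro a b
    exact subharmonic_sub_one (hu.2.2 a b) (fun ζ hζ => hneg _ hζ)

/-- Points where `u` is finite are outside the hull. -/
lemma not_mem_bHull {D A : Set F} {u : F → EReal} (hu : PshOn u D) (hneg : ∀ z ∈ D, u z ≤ 0)
    (hA : ∀ x ∈ A, uscReg u D x = ⊥) {z : F} (hz : z ∈ D) (hzu : u z ≠ ⊥) :
    z ∉ bHull A D := by
  intro hmem
  have hzv : u z + ((-1 : ℝ) : EReal) ≠ ⊥ := by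
    rw [Ne, EReal.add_eq_bot_iff]
    exact not_or.2 ⟨hzu, EReal.coe_ne_bot _⟩
  have h := hmem.2 _ (psh_sub_one hu hneg) ?_ ⟨z, hz, hzv⟩ ?_
  · apply hzv
    rw [eq_bot_iff, ← h]
    unfold uscReg
    refine le_limsup_of_frequently_le' ?_
    have : (pure z : Filter F) ≤ 𝓝[D] z := pure_le_nhdsWithin hz
    exact Filter.Frequently.filter_mono (by simp) this
  · intro y hy
    calc u y + ((-1 : ℝ) : EReal) ≤ 0 + ((-1 : ℝ) : EReal) := mono_add_neg_one (hneg y hy)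
      _ < 0 := by rw [zero_add]; exact_mod_cast (by norm_num : (-1 : ℝ) < 0)
  · intro x hx
    rw [eq_bot_iff, ← hA x hx]
    exact limsup_le_limsup (Eventually.of_forall fun y => add_neg_one_le _)

/-- A compact subset of the closure of `S` can be approximated by a sequence in `S`. -/
lemma exists_approach {X : Type*} [MetricSpace X] {S K : Set X} (hK : IsCompact K)
    (hKS : K ⊆ closure S) : ∃ L ⊆ S, K ⊆ closure L ∧ IsCompact (L ∪ K) := by
  have hstep : ∀ k : ℕ, ∃ T : Set X, T.Finite ∧ T ⊆ S ∧
      (∀ t ∈ T, ∃ x ∈ K, dist t x < 1 / ((k : ℝ) + 1)) ∧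
      (∀ x ∈ K, ∃ t ∈ T, dist x t < 2 * (1 / ((k : ℝ) + 1))) := by
    intro k
    have hk : (0 : ℝ) < 1 / ((k : ℝ) + 1) := by positivity
    obtain ⟨N, hNK, hNf, hN⟩ := hK.finite_cover_balls hk
    have hch : ∀ x : X, ∃ s, x ∈ K → s ∈ S ∧ dist x s < 1 / ((k : ℝ) + 1) := by
      intro x
      by_cases hx : x ∈ K
      · obtain ⟨s, hs, h⟩ := Metric.mem_closure_iff.1 (hKS hx) _ hk
        exact ⟨s, fun _ => ⟨hs, h⟩⟩
      · exact ⟨x, fun h => absurd h hx⟩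
    choose f hf using hch
    refine ⟨f '' N, hNf.image f, ?_, ?_, ?_⟩
    · rintro _ ⟨x, hx, rfl⟩
      exact (hf x (hNK hx)).1
    · rintro _ ⟨x, hx, rfl⟩
      exact ⟨x, hNK hx, by rw [dist_comm]; exact (hf x (hNK hx)).2⟩
    · intro x hx
      obtain ⟨y, hy, hxy⟩ := mem_iUnion₂.1 (hN hx)
      refine ⟨f y, ⟨y, hy, rfl⟩, ?_⟩
      have h1 : dist x y < _ := hxy
      have h2 := (hf y (hNK hy)).2
      have := dist_triangle x y (f y)
      linarith
  choose T hTf hTS hTK hKT using hstep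
  refine ⟨⋃ k, T k, iUnion_subset hTS, ?_, ?_⟩
  · intro x hx
    rw [Metric.mem_closure_iff]
    intro ε hε
    obtain ⟨k, hk⟩ := exists_nat_one_div_lt (show (0 : ℝ) < ε / 2 by linarith)
    obtain ⟨t, ht, h⟩ := hKT k x hx
    exact ⟨t, mem_iUnion.2 ⟨k, ht⟩, by linarith⟩
  · rw [isCompact_iff_finite_subcover]
    intro ι V hVo hV
    obtain ⟨s, hs⟩ := hK.elim_finite_subcover V hVo (subset_union_right.trans hV)
    have hO : IsOpen (⋃ i ∈ s, V i) := isOpen_biUnion fun i _ => hVo i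
    obtain ⟨δ, hδ, hthick⟩ := hK.exists_thickening_subset_open hO hs
    obtain ⟨k₀, hk₀⟩ := exists_nat_one_div_lt hδ
    have hfin : (⋃ k ∈ Finset.range k₀, T k).Finite :=
      (Finset.range k₀).finite_toSet.biUnion fun k _ => hTf k
    have hsub : (⋃ k ∈ Finset.range k₀, T k) ⊆ ⋃ i, V i :=
      (iUnion₂_subset fun k _ => subset_iUnion T k).trans (subset_union_left.trans hV)
    obtain ⟨s', hs'⟩ := hfin.isCompact.elim_finite_subcover V hVo hsub
    classical
    refine ⟨s ∪ s', ?_⟩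
    rw [Finset.set_biUnion_union]
    apply union_subset
    · apply iUnion_subset
      intro k t ht
      by_cases hk : k < k₀
      · exact Or.inr (hs' (mem_iUnion₂.2 ⟨k, Finset.mem_range.2 hk, ht⟩))
      · left
        apply hthick
        obtain ⟨x, hx, h⟩ := hTK k t ht
        rw [Metric.mem_thickening_iff]
        refine ⟨x, hx, h.trans (lt_of_le_of_lt ?_ hk₀)⟩
        apply one_div_le_one_div_of_le (by positivity)
        have : (k₀ : ℝ) ≤ k := by exact_mod_cast not_lt.1 hk
        linarith
    · exact hs.trans subset_union_left

/-- If `A ⊆ ∂D` is b-pluripolar and `K ⊆ ∂D \ A` is compact, then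
there is `L ⊆ D \ Â` with `K ⊆ cl(L)` and `L ∪ K` compact. -/
theorem exists_compact_approach_set {n : ℕ}
    (D A K : Set (EuclideanSpace ℂ (Fin n))) (hD : IsBddDomain D)
    (hA : A ⊆ frontier D) (hbp : BPluripolar A D)
    (hK : IsCompact K) (hKsub : K ⊆ frontier D \ A) :
    ∃ L : Set (EuclideanSpace ℂ (Fin n)),
      L ⊆ D \ bHull A D ∧ K ⊆ closure L ∧ IsCompact (L ∪ K) := by
  obtain ⟨u, hu, hneg, hne, huA⟩ := hbp
  have hdense := subset_closure_ne_bot hD.1 hD.2.1.isPreconnected hu hneg hne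
  have hKS : K ⊆ closure {z ∈ D | u z ≠ ⊥} := fun x hx =>
    closure_minimal hdense isClosed_closure (frontier_subset_closure (hKsub hx).1)
  obtain ⟨L, hLS, hKL, hc⟩ := exists_approach hK hKS
  exact ⟨L, fun z hz => ⟨(hLS hz).1, not_mem_bHull hu hneg huA (hLS hz).1 (hLS hz).2⟩, hKL, hc⟩
end
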